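/- arXiv:math/0201001 — 2 statements merged into one kernel-verified Lean document; each statement's English description precedes it below -/
import Mathlib

section
/- Let D ⊂ B be a unital subalgebra with a conditional expectation F: B → D, so that (M, F∘E) is a D-probability space. Let X_1,…,X_n ∈ M and assume that the B-valued cumulants of X_1,…,X_n satisfy k^{X_1,…,X_n}_{B;i_1,…,i_k}(d_1,…,d_{k-1}) ∈ D for all k ≥ 1 and all d_1,…,d_{k-1} ∈ D. Then the D-valued cumulants of X_1,…,X_n are the restrictions of the B-valued cumulants: k^{X_1,…,X_n}_{D;i_1,…,i_k}(d_1,…,d_{k-1}) = k^{X_1,…,X_n}_{B;i_1,…,i_k}(d_1,…,d_{k-1}) for all k ≥ 1 and all d_1,…,d_{k-1} ∈ D. -/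
/-!  Statement 0 (Theorem 3.1 of Nica-Shlyakhtenko-Speicher, "Operator-valued
distributions I"):  if the `B`-valued cumulants of `X₁,…,Xₙ`, evaluated on
arguments from `D`, take values in `D`, then the `D`-valued cumulants (with
respect to the conditional expectation `F ∘ E`) are the restrictions of the
`B`-valued ones. -/

open scoped Classical

noncomputable section

namespace OVD

variable {M : Type*} [Ring M] [Algebra ℂ M]

/-- The (ordered) product of the `m i` over the indices `i` with `a < i < b`. -/
def gapProd {n : ℕ} (m : Fin n → M) (a b : ℕ) : M :=
  (((List.finRange n).filter (fun i : Fin n => decide (a < (i : ℕ) ∧ (i : ℕ) < b))).map m).prod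

/-- `E : M → M` is a conditional expectation onto the unital subalgebra `B`. -/
def IsCondExp (B : Subalgebra ℂ M) (E : M →ₗ[ℂ] M) : Prop :=
  E 1 = 1 ∧ (∀ x, E x ∈ B) ∧ ∀ b ∈ B, ∀ b' ∈ B, ∀ x, E (b * x * b') = b * E x * b'

/-- `κ` is the family of operator-valued cumulant functionals for the
`B`-probability space `(M, E)`:  the maps are multilinear, take values in `B`,
and satisfy the moment-cumulant recursion
`E(m₁⋯mₙ) = ∑_{π ∈ NC(n)} κ_π(m₁,…,mₙ)`, written in its equivalent recursive
form obtained by summing over the block `S` of the first element of a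
non-crossing partition (the inner gaps between consecutive elements of `S`
contribute nested moments, and the part after the last element of `S`
contributes an outer moment factor). -/
structure IsCumulantFamily (B : Subalgebra ℂ M) (E : M →ₗ[ℂ] M)
    (κ : ∀ n : ℕ, MultilinearMap ℂ (fun _ : Fin n => M) M) : Prop where
  mem : ∀ (n : ℕ) (x : Fin n → M), κ n x ∈ B
  moment : ∀ (n : ℕ) (x : Fin (n + 1) → M),
    E ((List.ofFn x).prod) =
      ∑ S : Finset (Fin (n + 1)),
        if hS : (0 : Fin (n + 1)) ∈ S then
          (κ S.card fun j =>
            if h : (j : ℕ) + 1 < S.card then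
              x ((S.orderIsoOfFin rfl) j) *
                E (gapProd x (((S.orderIsoOfFin rfl) j : Fin (n + 1)) : ℕ)
                  (((S.orderIsoOfFin rfl) ⟨(j : ℕ) + 1, h⟩ : Fin (n + 1)) : ℕ))
            else x ((S.orderIsoOfFin rfl) j)) *
          E (gapProd x
            (((S.orderIsoOfFin rfl)
                ⟨S.card - 1, Nat.sub_lt (Finset.card_pos.mpr ⟨0, hS⟩) Nat.one_pos⟩ :
              Fin (n + 1)) : ℕ)
            (n + 1))
        else 0

/-- The cumulant series of the family `X`:
`k_{i₁,…,i_{k+1}}(b₁,…,b_k) = κ(X_{i₁} b₁, X_{i₂} b₂, …, X_{i_{k+1}})`. -/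
def cumulantSeries (κ : ∀ n : ℕ, MultilinearMap ℂ (fun _ : Fin n => M) M)
    {ι : Type*} (X : ι → M) {k : ℕ} (i : Fin (k + 1) → ι) (b : Fin k → M) : M :=
  κ (k + 1) fun j => if h : (j : ℕ) < k then X (i j) * b ⟨(j : ℕ), h⟩ else X (i j)

/-- Multiply the last entry of a tuple on the right by `b`. -/
def mulLast {n : ℕ} (x : Fin n → M) (b : M) : Fin n → M :=
  fun j => if (j : ℕ) + 1 = n then x j * b else x j

/-- The arguments of the cumulant attached to the block `S` in the moment-cumulant recursion. -/
def blockArgs (E : M →ₗ[ℂ] M) {n : ℕ} (x : Fin n → M) (S : Finset (Fin n)) :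
    Fin S.card → M := fun j =>
  if h : (j : ℕ) + 1 < S.card then
    x ((S.orderIsoOfFin rfl) j) *
      E (gapProd x (((S.orderIsoOfFin rfl) j : Fin n) : ℕ)
        (((S.orderIsoOfFin rfl) ⟨(j : ℕ) + 1, h⟩ : Fin n) : ℕ))
  else x ((S.orderIsoOfFin rfl) j)

/-- The contribution of the block `S ∋ 0` to the moment-cumulant recursion. -/
def blockTerm (E : M →ₗ[ℂ] M) (κ : ∀ n : ℕ, MultilinearMap ℂ (fun _ : Fin n => M) M) {n : ℕ}
    (x : Fin (n + 1) → M) (S : Finset (Fin (n + 1))) : M :=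
  if hS : (0 : Fin (n + 1)) ∈ S then
    κ S.card (blockArgs E x S) *
      E (gapProd x
        (((S.orderIsoOfFin rfl)
            ⟨S.card - 1, Nat.sub_lt (Finset.card_pos.mpr ⟨0, hS⟩) Nat.one_pos⟩ :
          Fin (n + 1)) : ℕ)
        (n + 1))
  else 0

theorem IsCumulantFamily.moment_eq_sum_blockTerm {B : Subalgebra ℂ M} {E : M →ₗ[ℂ] M}
    {κ : ∀ n : ℕ, MultilinearMap ℂ (fun _ : Fin n => M) M} (hκ : IsCumulantFamily B E κ)
    {n : ℕ} (x : Fin (n + 1) → M) :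
    E (List.ofFn x).prod = ∑ S, blockTerm E κ x S :=
  hκ.moment n x

omit [Algebra ℂ M] in
theorem gapProd_congr {n : ℕ} {x y : Fin n → M} {a b : ℕ}
    (h : ∀ i : Fin n, a < i → (i : ℕ) < b → x i = y i) : gapProd x a b = gapProd y a b := by
  unfold gapProd
  congr 1
  apply List.map_congr_left
  intro i hi
  simp only [List.mem_filter, decide_eq_true_eq] at hi
  exact h i hi.2.1 hi.2.2

omit [Algebra ℂ M] in
theorem gapProd_eq_one {n : ℕ} (x : Fin n → M) {a b : ℕ} (h : b ≤ a + 1) :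
    gapProd x a b = 1 := by
  unfold gapProd
  rw [List.filter_eq_nil_iff.mpr]
  · simp
  · intro i _
    simp only [decide_eq_true_eq]
    omega

omit [Algebra ℂ M] in
theorem gapProd_mulLast {n : ℕ} (x : Fin (n + 1) → M) (b : M) {a : ℕ} (h : a < n) :
    gapProd (mulLast x b) a (n + 1) = gapProd x a (n + 1) * b := by
  have key : ∀ y : Fin (n + 1) → M,
      gapProd y a (n + 1) = gapProd (fun i : Fin n => y i.castSucc) a (n + 1) * y (Fin.last n) := by
    intro y
    simp [gapProd, List.finRange_succ_last, List.filter_append, List.filter_map, h,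
      Function.comp_def]
  rw [key, key x, mul_assoc]
  congr 1
  · apply gapProd_congr
    intro i _ _
    have := i.isLt
    simp only [mulLast, Fin.val_castSucc]
    rw [if_neg (by omega)]
  · simp [mulLast]

theorem map_gapProd_mem {E : M →ₗ[ℂ] M} {D : Subalgebra ℂ M} {A : Set M} {n : ℕ}
    (hind : ∀ l : List M, l.length < n + 1 → (∀ m ∈ l, m ∈ A) → E l.prod ∈ D)
    {x : Fin (n + 1) → M} (hx : ∀ i, x i ∈ A) (a b : ℕ) : E (gapProd x a b) ∈ D := by
  apply hind
  · rw [List.length_map]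
    refine lt_of_lt_of_eq (b := (List.finRange (n + 1)).length) ?_ (by simp)
    rw [List.length_filter_lt_length_iff_exists]
    exact ⟨0, by simp, by simp⟩
  · intro m hm
    obtain ⟨i, _, rfl⟩ := List.mem_map.mp hm
    exact hx i

theorem orderIsoOfFin_univ {n : ℕ} (j : Fin (Finset.univ : Finset (Fin n)).card) :
    (((Finset.univ : Finset (Fin n)).orderIsoOfFin rfl j : Fin n) : ℕ) = j := by
  have h : (Finset.univ : Finset (Fin n)).card = n := by simp
  have := Finset.orderEmbOfFin_unique (s := (Finset.univ : Finset (Fin n))) rfl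
    (f := Fin.cast h) (by simp) (fun a b hab => hab)
  rw [Finset.coe_orderIsoOfFin_apply, ← this]
  rfl

theorem map_cast (κ : ∀ n : ℕ, MultilinearMap ℂ (fun _ : Fin n => M) M) {m n : ℕ} (h : m = n)
    (y : Fin m → M) (x : Fin n → M) (hxy : ∀ j, y j = x (Fin.cast h j)) : κ m y = κ n x := by
  subst h
  exact congrArg (κ m) (funext hxy)

theorem blockTerm_univ {E : M →ₗ[ℂ] M} (hE : E 1 = 1)
    (κ : ∀ n : ℕ, MultilinearMap ℂ (fun _ : Fin n => M) M) {n : ℕ} (x : Fin (n + 1) → M) :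
    blockTerm E κ x Finset.univ = κ (n + 1) x := by
  have hc : (Finset.univ : Finset (Fin (n + 1))).card = n + 1 := by simp
  rw [blockTerm, dif_pos (Finset.mem_univ _), gapProd_eq_one, hE, mul_one]
  · apply map_cast κ hc
    intro j
    have hj : ((Finset.univ.orderIsoOfFin rfl j : _) : Fin (n + 1)) = Fin.cast hc j :=
      Fin.ext (orderIsoOfFin_univ j)
    unfold blockArgs
    split_ifs with h
    · rw [gapProd_eq_one, hE, mul_one, hj]
      rw [orderIsoOfFin_univ, orderIsoOfFin_univ]
    · rw [hj]
  · rw [orderIsoOfFin_univ]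
    simp

theorem orderIsoOfFin_lt_last {n : ℕ} {S : Finset (Fin n)} {j : Fin S.card}
    (hj : (j : ℕ) + 1 < S.card) : ((S.orderIsoOfFin rfl j : Fin n) : ℕ) + 1 < n := by
  have h : S.orderIsoOfFin rfl j < S.orderIsoOfFin rfl ⟨j + 1, hj⟩ :=
    (S.orderIsoOfFin rfl).lt_iff_lt.mpr (Fin.lt_def.mpr (Nat.lt_succ_self _))
  have h' : ((S.orderIsoOfFin rfl j : Fin n) : ℕ) <
      (S.orderIsoOfFin rfl ⟨j + 1, hj⟩ : Fin n) := h
  have := (S.orderIsoOfFin rfl ⟨j + 1, hj⟩ : Fin n).isLt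
  omega

/-- The arguments of a block before its last entry do not see the last entry of the tuple. -/
theorem blockArgs_mulLast_of_lt (E : M →ₗ[ℂ] M) {n : ℕ} (x : Fin n → M) (b : M)
    (S : Finset (Fin n)) {j : Fin S.card} (hj : (j : ℕ) + 1 < S.card) :
    blockArgs E (mulLast x b) S j = blockArgs E x S j := by
  unfold blockArgs
  rw [dif_pos hj, dif_pos hj]
  congr 1
  · rw [mulLast, if_neg (orderIsoOfFin_lt_last hj).ne]
  · congr 1
    apply gapProd_congr
    intro i _ hi
    have := (S.orderIsoOfFin rfl ⟨j + 1, hj⟩ : Fin n).isLt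
    rw [mulLast, if_neg (by omega)]

theorem blockArgs_last (E : M →ₗ[ℂ] M) {n : ℕ} (x : Fin n → M) (S : Finset (Fin n))
    {j : Fin S.card} (hj : ¬ (j : ℕ) + 1 < S.card) :
    blockArgs E x S j = x (S.orderIsoOfFin rfl j) := by
  rw [blockArgs, dif_neg hj]

theorem card_lt_of_ne_univ {n : ℕ} {S : Finset (Fin n)} (hS : S ≠ Finset.univ) : S.card < n := by
  simpa using Finset.card_lt_card (Finset.ssubset_univ_iff.mpr hS)

theorem blockTerm_mulLast {B : Subalgebra ℂ M} {E : M →ₗ[ℂ] M} (hE : IsCondExp B E)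
    (κ : ∀ n : ℕ, MultilinearMap ℂ (fun _ : Fin n => M) M) {n : ℕ} (x : Fin (n + 1) → M)
    {b : M} (hb : b ∈ B) (S : Finset (Fin (n + 1)))
    (hκ : ∀ y : Fin S.card → M, κ S.card (mulLast y b) = κ S.card y * b) :
    blockTerm E κ (mulLast x b) S = blockTerm E κ x S * b := by
  unfold blockTerm
  split_ifs with h0
  swap
  · simp
  have hpos : 0 < S.card := Finset.card_pos.mpr ⟨0, h0⟩
  set l : Fin S.card := ⟨S.card - 1, Nat.sub_lt hpos Nat.one_pos⟩ with hl
  have eq_l : ∀ j : Fin S.card, ¬ (j : ℕ) + 1 < S.card → j = l := by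
    intro j hj
    apply Fin.ext
    have := j.isLt
    simp only [hl]
    omega
  by_cases hlast : ((S.orderIsoOfFin rfl l : Fin (n + 1)) : ℕ) = n
  · rw [gapProd_eq_one _ (by omega), gapProd_eq_one _ (by omega), hE.1, mul_one, mul_one, ← hκ]
    congr 1
    funext j
    by_cases hj : (j : ℕ) + 1 < S.card
    · rw [blockArgs_mulLast_of_lt E x b S hj]
      unfold mulLast
      rw [if_neg hj.ne]
    · have hjl := eq_l j hj
      have := j.isLt
      rw [blockArgs_last E _ S hj]
      unfold mulLast
      rw [blockArgs_last E _ S hj, if_pos (show (j : ℕ) + 1 = S.card by omega), if_pos]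
      rw [hjl, hlast]
  · have hlt := (S.orderIsoOfFin rfl l : Fin (n + 1)).isLt
    rw [gapProd_mulLast x b (by omega), mul_assoc]
    congr 1
    · congr 1
      funext j
      by_cases hj : (j : ℕ) + 1 < S.card
      · exact blockArgs_mulLast_of_lt E x b S hj
      · rw [blockArgs_last E _ S hj, blockArgs_last E _ S hj, mulLast, if_neg]
        rw [eq_l j hj]
        omega
    · simpa using hE.2.2 1 B.one_mem b hb
        (gapProd x ((S.orderIsoOfFin rfl l : Fin (n + 1)) : ℕ) (n + 1))

omit [Algebra ℂ M] in
theorem prod_ofFn_mulLast {n : ℕ} (x : Fin (n + 1) → M) (b : M) :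
    (List.ofFn (mulLast x b)).prod = (List.ofFn x).prod * b := by
  rw [List.ofFn_succ', List.ofFn_succ', List.concat_eq_append, List.concat_eq_append,
    List.prod_append, List.prod_append, mul_assoc]
  congr 1
  · congr 2
    funext i
    have := i.isLt
    simp only [mulLast, Fin.val_castSucc]
    rw [if_neg (by omega)]
  · simp [mulLast]

/-- Operator-valued cumulants are right `B`-linear in their last argument. -/
theorem IsCumulantFamily.map_mulLast {B : Subalgebra ℂ M} {E : M →ₗ[ℂ] M}
    (hE : IsCondExp B E) {κ : ∀ n : ℕ, MultilinearMap ℂ (fun _ : Fin n => M) M}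
    (hκ : IsCumulantFamily B E κ) {b : M} (hb : b ∈ B) :
    ∀ (n : ℕ) (x : Fin (n + 1) → M), κ (n + 1) (mulLast x b) = κ (n + 1) x * b := by
  intro n
  induction n using Nat.strong_induction_on with
  | _ n ih =>
    intro x
    have h1 := hκ.moment_eq_sum_blockTerm (mulLast x b)
    have h3 : E ((List.ofFn x).prod * b) = E (List.ofFn x).prod * b := by
      simpa using hE.2.2 1 B.one_mem b hb (List.ofFn x).prod
    rw [prod_ofFn_mulLast, h3, hκ.moment_eq_sum_blockTerm x, Finset.sum_mul,
      ← Finset.add_sum_erase _ _ (Finset.mem_univ Finset.univ),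
      ← Finset.add_sum_erase _ (blockTerm E κ (mulLast x b)) (Finset.mem_univ Finset.univ),
      blockTerm_univ hE.1, blockTerm_univ hE.1] at h1
    refine (add_right_cancel (h1.trans ?_)).symm
    congr 1
    refine Finset.sum_congr rfl fun S hS => ?_
    by_cases h0 : (0 : Fin (n + 1)) ∈ S
    · apply blockTerm_mulLast hE κ x hb
      have hlt := card_lt_of_ne_univ (Finset.ne_of_mem_erase hS)
      have hpos : 0 < S.card := Finset.card_pos.mpr ⟨0, h0⟩
      obtain ⟨m, hm⟩ : ∃ m, S.card = m + 1 := ⟨S.card - 1, by omega⟩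
      rw [hm]
      exact ih m (by omega)
    · simp [blockTerm, h0]

theorem blockArgs_mem {E : M →ₗ[ℂ] M} {D : Subalgebra ℂ M} {A : Set M}
    (hA : ∀ a ∈ A, ∀ d ∈ D, a * d ∈ A) {n : ℕ} {x : Fin n → M} (hx : ∀ i, x i ∈ A)
    (hE : ∀ a b, E (gapProd x a b) ∈ D) (S : Finset (Fin n)) (j : Fin S.card) :
    blockArgs E x S j ∈ A := by
  unfold blockArgs
  split_ifs
  · exact hA _ (hx _) _ (hE _ _)
  · exact hx _

/-- If the cumulants of elements of a right `D`-invariant set `A` lie in `D`, then so do the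
moments. -/
theorem IsCumulantFamily.moment_mem {B D : Subalgebra ℂ M} {E : M →ₗ[ℂ] M} (hE : E 1 = 1)
    {κ : ∀ n : ℕ, MultilinearMap ℂ (fun _ : Fin n => M) M} (hκ : IsCumulantFamily B E κ)
    {A : Set M} (hA : ∀ a ∈ A, ∀ d ∈ D, a * d ∈ A)
    (hmem : ∀ (n : ℕ) (x : Fin n → M), 0 < n → (∀ i, x i ∈ A) → κ n x ∈ D) (l : List M)
    (hl : ∀ m ∈ l, m ∈ A) : E l.prod ∈ D := by
  induction hn : l.length using Nat.strong_induction_on generalizing l with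
  | _ k ih =>
    subst hn
    rcases l with _ | ⟨a, l⟩
    · simp [hE]
    set x : Fin (l.length + 1) → M := (a :: l).get
    have hxA : ∀ i, x i ∈ A := fun i => hl _ (List.get_mem _ _)
    have hgap : ∀ p q, E (gapProd x p q) ∈ D :=
      map_gapProd_mem (fun l' hlt hl' => ih l'.length hlt l' hl' rfl) hxA
    have hprod : (List.ofFn x).prod = (a :: l).prod := congrArg _ (List.ofFn_get (a :: l))
    rw [← hprod, hκ.moment_eq_sum_blockTerm]
    refine sum_mem fun S _ => ?_
    unfold blockTerm
    split_ifs with h0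
    · exact D.mul_mem (hmem _ _ (Finset.card_pos.mpr ⟨0, h0⟩) (blockArgs_mem hA hxA hgap S))
        (hgap _ _)
    · exact D.zero_mem

/-- Two cumulant families whose moments agree on words in a set `A`, right invariant under a
subalgebra `D` containing these moments, agree on `A`. -/
theorem IsCumulantFamily.eq_of_moment_eq {B B' D : Subalgebra ℂ M} {E E' : M →ₗ[ℂ] M}
    (hE : E 1 = 1) (hE' : E' 1 = 1)
    {κ κ' : ∀ n : ℕ, MultilinearMap ℂ (fun _ : Fin n => M) M} (hκ : IsCumulantFamily B E κ)
    (hκ' : IsCumulantFamily B' E' κ') {A : Set M} (hA : ∀ a ∈ A, ∀ d ∈ D, a * d ∈ A)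
    (hmem : ∀ l : List M, (∀ m ∈ l, m ∈ A) → E l.prod ∈ D)
    (heq : ∀ l : List M, (∀ m ∈ l, m ∈ A) → E' l.prod = E l.prod) :
    ∀ (n : ℕ) (x : Fin (n + 1) → M), (∀ i, x i ∈ A) → κ' (n + 1) x = κ (n + 1) x := by
  intro n
  induction n using Nat.strong_induction_on with
  | _ n ih =>
    intro x hx
    have h1 := heq (List.ofFn x) (List.forall_mem_ofFn_iff.mpr hx)
    have hgap : ∀ p q, E (gapProd x p q) ∈ D := map_gapProd_mem (fun l _ hl => hmem l hl) hx
    have hgapeq : ∀ p q, E' (gapProd x p q) = E (gapProd x p q) := by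
      intro p q
      apply heq
      intro m hm
      obtain ⟨i, _, rfl⟩ := List.mem_map.mp hm
      exact hx i
    rw [hκ.moment_eq_sum_blockTerm, hκ'.moment_eq_sum_blockTerm,
      ← Finset.add_sum_erase _ _ (Finset.mem_univ Finset.univ),
      ← Finset.add_sum_erase _ (blockTerm E κ x) (Finset.mem_univ Finset.univ),
      blockTerm_univ hE, blockTerm_univ hE'] at h1
    refine add_right_cancel (h1.trans ?_)
    congr 1
    refine Finset.sum_congr rfl fun S hS => ?_
    unfold blockTerm
    split_ifs with h0
    · have hlt := card_lt_of_ne_univ (Finset.ne_of_mem_erase hS)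
      have hpos : 0 < S.card := Finset.card_pos.mpr ⟨0, h0⟩
      obtain ⟨m, hm⟩ : ∃ m, S.card = m + 1 := ⟨S.card - 1, by omega⟩
      have hargs : blockArgs E' x S = blockArgs E x S := by
        funext j
        simp only [blockArgs, hgapeq]
      have hcum : ∀ y : Fin S.card → M, (∀ i, y i ∈ A) → κ' S.card y = κ S.card y := by
        rw [hm]
        exact ih m (by omega)
      rw [hargs, hgapeq, hcum _ (blockArgs_mem hA hx hgap S)]
    · rfl

/-- Let `D ⊆ B ⊆ M`, let `E : M → B` be a conditional
expectation and `F : B → D` a conditional expectation, so that `(M, F ∘ E)` is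
a `D`-probability space.  If the `B`-valued cumulant series of `X₁,…,Xₙ`
evaluated at arguments from `D` takes values in `D`, then the `D`-valued
cumulant series coincides with (the restriction of) the `B`-valued one. -/
theorem cumulants_restrict_of_valued_in_D
    (B D : Subalgebra ℂ M) (hDB : D ≤ B)
    (E F : M →ₗ[ℂ] M) (hE : IsCondExp B E)
    (hF1 : F 1 = 1) (hFD : ∀ b ∈ B, F b ∈ D)
    (hFbimod : ∀ d ∈ D, ∀ d' ∈ D, ∀ b ∈ B, F (d * b * d') = d * F b * d')
    (κB κD : ∀ n : ℕ, MultilinearMap ℂ (fun _ : Fin n => M) M)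
    (hκB : IsCumulantFamily B E κB) (hκD : IsCumulantFamily D (F ∘ₗ E) κD)
    {n : ℕ} (X : Fin n → M)
    (hval : ∀ (k : ℕ) (i : Fin (k + 1) → Fin n) (d : Fin k → M),
      (∀ j, d j ∈ D) → cumulantSeries κB X i d ∈ D) :
    ∀ (k : ℕ) (i : Fin (k + 1) → Fin n) (d : Fin k → M),
      (∀ j, d j ∈ D) → cumulantSeries κD X i d = cumulantSeries κB X i d := by
  have hF : ∀ d ∈ D, F d = d := by
    intro d hd
    simpa [hF1] using hFbimod d hd 1 D.one_mem 1 B.one_mem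
  set A : Set M := {a | ∃ i, ∃ d ∈ D, a = X i * d}
  have hA : ∀ a ∈ A, ∀ d ∈ D, a * d ∈ A := by
    rintro _ ⟨i, d, hd, rfl⟩ d' hd'
    exact ⟨i, d * d', D.mul_mem hd hd', mul_assoc _ _ _⟩
  have hcum : ∀ (m : ℕ) (x : Fin m → M), 0 < m → (∀ i, x i ∈ A) → κB m x ∈ D := by
    intro m x hm hx
    obtain ⟨k, rfl⟩ : ∃ k, m = k + 1 := ⟨m - 1, by omega⟩
    choose i d hd hxd using hx
    have hser := hval k i (fun j => d j.castSucc) (fun j => hd _)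
    have hx' : x = mulLast
        (fun j => if h : (j : ℕ) < k then X (i j) * d (Fin.castSucc ⟨j, h⟩) else X (i j))
        (d (Fin.last k)) := by
      funext j
      unfold mulLast
      have := j.isLt
      by_cases h : (j : ℕ) < k
      · simp only [if_neg (show ¬ (j : ℕ) + 1 = k + 1 by omega), dif_pos h]
        exact hxd j
      · have hj : j = Fin.last k := Fin.ext (by simp; omega)
        simp only [if_pos (show (j : ℕ) + 1 = k + 1 by omega), dif_neg h]
        rw [hxd, hj]
    rw [hx', hκB.map_mulLast hE (hDB (hd _))]
    exact D.mul_mem hser (hd _)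
  have hmom := hκB.moment_mem hE.1 hA hcum
  intro k i d hd
  refine hκB.eq_of_moment_eq hE.1 (by simp [hE.1, hF1]) hκD hA hmom
    (fun l hl => hF _ (hmom l hl)) k _ fun j => ?_
  split_ifs with h
  · exact ⟨_, _, hd _, rfl⟩
  · exact ⟨i j, 1, D.one_mem, (mul_one _).symm⟩

end OVD
end
end

section
/- Let (M, E: M → B) be a B-probability space, let D ⊂ B be a unital subalgebra, and let F: B → D be a conditional expectation satisfying the faithfulness condition: if b₁ ∈ B and F(b₁b₂) = 0 for all b₂ ∈ B, then b₁ = 0. Let X_1,…,X_n ∈ M. Then X_1,…,X_n are free from B with amalgamation over D if and only if their B-valued cumulant series satisfies k^{X_1,…,X_n}_{B;i_1,…,i_k}(b_1,…,b_{k-1}) = F( k^{X_1,…,X_n}_{B;i_1,…,i_k}(F(b_1),…,F(b_{k-1})) ) for all k, all indices, and all b_1,…,b_{k-1} ∈ B; equivalently, if and only if k^{X_1,…,X_n}_{B;i_1,…,i_k}(b_1,…,b_{k-1}) = k^{X_1,…,X_n}_{D;i_1,…,i_k}(F(b_1),…,F(b_{k-1})) for all such arguments, where k_D denotes the cumulant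 series in the D-probability space (M, F∘E). -/
/-!  Statement 4 (Theorem 3.5, first main result):  `X₁,…,Xₙ` are free from `B` with amalgamation over `D` iff their `B`-valued cumulant series factorizes through `F`, equivalently iff it is given by the `D`-valued cumulant series composed with `F`. -/

open scoped Classical

noncomputable section

namespace OVD

variable {M : Type*} [Ring M] [Algebra ℂ M]

/-- Two subsets `S₁, S₂` of `A` (each thought of as a subalgebra containing the
base algebra) are free with amalgamation with respect to the conditional
expectation `E` (valued in the module `W`):  every alternating product of
`E`-centered elements is `E`-centered. -/
def IsFreeWithAmalgamation {A W : Type*} [Ring A] [Algebra ℂ A]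
    [AddCommGroup W] [Module ℂ W] (E : A →ₗ[ℂ] W) (S₁ S₂ : Set A) : Prop :=
  ∀ (k : ℕ), 0 < k → ∀ (a : Fin k → A) (f : Fin k → Bool),
    (∀ j, a j ∈ (if f j then S₁ else S₂)) →
    (∀ j, E (a j) = 0) →
    (∀ (j : ℕ) (h : j + 1 < k), f ⟨j, Nat.lt_of_succ_lt h⟩ ≠ f ⟨j + 1, h⟩) →
    E ((List.ofFn a).prod) = 0

/-- The cumulant functional of a list of arguments. -/
def cumList (κ : ∀ n : ℕ, MultilinearMap ℂ (fun _ : Fin n => M) M) (l : List M) : M :=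
  κ l.length fun j => l.getD j 0

/-- The sum over the subsets of `l` (the further elements of a block whose previous
elements contributed the arguments `p`, whose current element is `x` and whose current gap has
product `u`) of the corresponding terms of the moment-cumulant recursion. -/
def expand (E : M →ₗ[ℂ] M) (k : List M → M) : List M → M → M → List M → M
  | p, x, u, [] => k (p ++ [x]) * E u
  | p, x, u, y :: l => expand E k p x (u * y) l + expand E k (p ++ [x * E u]) y 1 l

/-- The cumulant arguments attached to the block with first element `a` and further elements
given by a list. -/
def blockEntries (E : M →ₗ[ℂ] M) {n : ℕ} (x : Fin n → M) : Fin n → List (Fin n) → List M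
  | a, [] => [x a]
  | a, s :: ss => (x a * E (gapProd x a s)) :: blockEntries E x s ss

theorem cumList_eq (κ : ∀ n : ℕ, MultilinearMap ℂ (fun _ : Fin n => M) M) {l : List M} {N : ℕ}
    (h : l.length = N) : cumList κ l = κ N fun j => l.getD j 0 := by
  subst h; rfl

theorem cumList_ofFn (κ : ∀ n : ℕ, MultilinearMap ℂ (fun _ : Fin n => M) M) {N : ℕ}
    (f : Fin N → M) : cumList κ (List.ofFn f) = κ N f := by
  rw [cumList_eq κ (List.length_ofFn (f := f))]
  congr 1
  funext j
  simp [List.getD_eq_getElem?_getD]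

theorem isLinearMap_cumList (κ : ∀ n : ℕ, MultilinearMap ℂ (fun _ : Fin n => M) M)
    (p q : List M) : IsLinearMap ℂ fun y => cumList κ (p ++ y :: q) := by
  have key : ∀ y, cumList κ (p ++ y :: q) =
      κ (p.length + (q.length + 1))
        (Function.update (fun j => (p ++ 0 :: q).getD j 0) ⟨p.length, by omega⟩ y) := by
    intro y
    rw [cumList_eq κ (N := p.length + (q.length + 1)) (by simp)]
    congr 1
    funext j
    rcases lt_trichotomy (j : ℕ) p.length with h | h | h
    · rw [Function.update_of_ne (by intro e; rw [e] at h; simp at h)]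
      rw [List.getD_append _ _ _ _ h, List.getD_append _ _ _ _ h]
    · rw [show j = ⟨p.length, by omega⟩ from Fin.ext h, Function.update_self]
      simp [List.getD_eq_getElem?_getD]
    · rw [Function.update_of_ne (by intro e; rw [e] at h; simp at h)]
      obtain ⟨m, hm⟩ : ∃ m, (j : ℕ) - p.length = m + 1 := ⟨j - p.length - 1, by omega⟩
      rw [List.getD_append_right _ _ _ _ h.le, List.getD_append_right _ _ _ _ h.le, hm,
        List.getD_cons_succ, List.getD_cons_succ]
  refine ⟨fun y z => ?_, fun c y => ?_⟩
  · simp only [key, MultilinearMap.map_update_add]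
  · simp only [key, MultilinearMap.map_update_smul]

theorem length_blockEntries (E : M →ₗ[ℂ] M) {n : ℕ} (x : Fin n → M) (a : Fin n)
    (ss : List (Fin n)) : (blockEntries E x a ss).length = ss.length + 1 := by
  induction ss generalizing a with
  | nil => rfl
  | cons s ss ih => simp [blockEntries, ih]

theorem getElem_blockEntries (E : M →ₗ[ℂ] M) {n : ℕ} (x : Fin n → M) (a : Fin n)
    (ss : List (Fin n)) (j : ℕ) (hj : j < (blockEntries E x a ss).length)
    (hj' : j < (a :: ss).length) :
    (blockEntries E x a ss)[j] =
      if h : j + 1 < (a :: ss).length then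
        x (a :: ss)[j] * E (gapProd x ((a :: ss)[j] : Fin n) ((a :: ss)[j + 1] : Fin n))
      else x (a :: ss)[j] := by
  induction ss generalizing a j with
  | nil =>
    obtain rfl : j = 0 := by simpa using hj'
    simp [blockEntries]
  | cons s ss ih =>
    cases j with
    | zero => simp [blockEntries]
    | succ j =>
      simp only [blockEntries, List.getElem_cons_succ]
      rw [ih s j _ (by simpa using hj')]
      simp

theorem block_term_eq (E : M →ₗ[ℂ] M) (κ : ∀ n : ℕ, MultilinearMap ℂ (fun _ : Fin n => M) M)
    {n : ℕ} (x : Fin (n + 1) → M) (S : Finset (Fin (n + 1))) (hS : (0 : Fin (n + 1)) ∈ S)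
    (ss : List (Fin (n + 1))) (hss : S.sort (· ≤ ·) = 0 :: ss) :
    (κ S.card fun j =>
        if h : (j : ℕ) + 1 < S.card then
          x ((S.orderIsoOfFin rfl) j) *
            E (gapProd x (((S.orderIsoOfFin rfl) j : Fin (n + 1)) : ℕ)
              (((S.orderIsoOfFin rfl) ⟨(j : ℕ) + 1, h⟩ : Fin (n + 1)) : ℕ))
        else x ((S.orderIsoOfFin rfl) j)) *
      E (gapProd x
        (((S.orderIsoOfFin rfl)
            ⟨S.card - 1, Nat.sub_lt (Finset.card_pos.mpr ⟨0, hS⟩) Nat.one_pos⟩ :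
          Fin (n + 1)) : ℕ)
        (n + 1)) =
    cumList κ (blockEntries E x 0 ss) * E (gapProd x (ss.getLastD 0 : Fin (n + 1)) (n + 1)) := by
  have hcard : S.card = (0 :: ss).length := by rw [← hss, Finset.length_sort]
  congr 1
  · rw [← cumList_ofFn]
    congr 1
    refine List.ext_getElem ?_ fun j hj hj' => ?_
    · simp [length_blockEntries, hcard]
    · rw [getElem_blockEntries E x 0 ss j hj' (by simpa [length_blockEntries] using hj')]
      simp only [List.getElem_ofFn, Finset.coe_orderIsoOfFin_apply, Finset.orderEmbOfFin_apply,
        Fin.getElem_fin, hss, hcard]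
      rfl
  · have e : S.card - 1 = ss.length := by simp [hcard]
    simp only [Finset.coe_orderIsoOfFin_apply, Finset.orderEmbOfFin_apply, Fin.getElem_fin, hss, e]
    rw [show (0 :: ss)[ss.length] = ss.getLastD 0 by
      rw [← List.getLast_eq_getLastD (List.cons_ne_nil 0 ss), List.getLast_eq_getElem]
      rfl]

theorem expand_eq_sum_sublists (E : M →ₗ[ℂ] M) (k : List M → M) {n : ℕ}
    (x : Fin n → M) (suf : List (Fin n)) :
    ∀ (pre : List (Fin n)) (a : Fin n) (p : List M), pre ++ suf = List.finRange n → a ∈ pre →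
      expand E k p (x a) ((pre.filter (a < ·)).map x).prod (suf.map x) =
        (suf.sublists'.map fun ss =>
          k (p ++ blockEntries E x a ss) * E (gapProd x (ss.getLastD a : Fin n) n)).sum := by
  induction suf with
  | nil =>
    intro pre a p hpre _
    rw [List.append_nil] at hpre
    subst hpre
    have h : gapProd x a n = (((List.finRange n).filter (a < ·)).map x).prod := by
      rw [gapProd, List.filter_congr (q := fun i => decide (a < i)) fun i _ => by simp]
    simp [expand, blockEntries, h]
  | cons m suf ih =>
    intro pre a p hpre ha
    have hpre' : (pre ++ [m]) ++ suf = List.finRange n := by simpa using hpre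
    have hsorted := hpre ▸ List.pairwise_lt_finRange n
    rw [List.pairwise_append, List.pairwise_cons] at hsorted
    have hlt : ∀ i ∈ pre, i < m := fun i hi => hsorted.2.2 i hi m (by simp)
    have hgt : ∀ i ∈ suf, m < i := hsorted.2.1.1
    have hgap : gapProd x a m = ((pre.filter (a < ·)).map x).prod := by
      have h1 : pre.filter (fun i : Fin n => decide ((a : ℕ) < i ∧ (i : ℕ) < m)) = pre.filter (a < ·) :=
        List.filter_congr fun i hi => by simp [hlt i hi]
      have h2 : suf.filter (fun i : Fin n => decide ((a : ℕ) < i ∧ (i : ℕ) < m)) = [] :=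
        List.filter_eq_nil_iff.2 fun i hi => by simp [(hgt i hi).le]
      rw [gapProd, ← hpre, List.filter_append, List.filter_cons, if_neg (by simp), h1, h2,
        List.append_nil]
    have hm : ((pre ++ [m]).filter (m < ·)) = [] := by
      rw [List.filter_eq_nil_iff]
      intro i hi
      rcases List.mem_append.1 hi with hi | hi
      · simpa using (hlt i hi).le
      · simp [List.mem_singleton.1 hi]
    have h1 := ih (pre ++ [m]) a p hpre' (by simp [ha])
    have h2 := ih (pre ++ [m]) m (p ++ [x a * E (gapProd x a m)]) hpre' (by simp)
    rw [hm] at h2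
    have hstep : ((pre ++ [m]).filter (a < ·)).map x = (pre.filter (a < ·)).map x ++ [x m] := by
      simp [List.filter_append, hlt a ha]
    rw [hstep, List.prod_append, List.prod_singleton] at h1
    rw [List.map_cons, expand, h1, ← hgap, List.sublists'_cons, List.map_append, List.sum_append,
      List.map_map]
    congr 1
    simpa only [blockEntries, Function.comp_def, List.getLastD_cons, List.append_assoc,
      List.singleton_append, List.map_nil, List.prod_nil] using h2

theorem sum_finset_eq_sum_sublists {n : ℕ} {A : Type*} [AddCommMonoid A]
    (f : List (Fin (n + 1)) → A) :
    (∑ S : Finset (Fin (n + 1)), if (0 : Fin (n + 1)) ∈ S then f (S.sort (· ≤ ·)).tail else 0) =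
      (((List.finRange n).map Fin.succ).sublists'.map f).sum := by
  have hpw : ((List.finRange n).map Fin.succ).Pairwise (· < ·) := by
    have := List.pairwise_lt_finRange (n + 1)
    rw [List.finRange_succ, List.pairwise_cons] at this
    exact this.2
  rw [← Finset.sum_filter, ← List.sum_toFinset _ (List.nodup_sublists'.2 (hpw.imp ne_of_lt))]
  have hsort : ∀ S : Finset (Fin (n + 1)), 0 ∈ S → S.sort (· ≤ ·) = 0 :: (S.sort (· ≤ ·)).tail := by
    intro S hS
    have hmem : (0 : Fin (n + 1)) ∈ S.sort (· ≤ ·) := (Finset.mem_sort _).2 hS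
    have hp := S.pairwise_sort (· ≤ ·)
    cases h : S.sort (· ≤ ·) with
    | nil => simp [h] at hmem
    | cons a l =>
      rw [h] at hmem hp
      rcases List.mem_cons.1 hmem with h0 | h0
      · simp [h0]
      · have := (List.pairwise_cons.1 hp).1 0 h0
        simp [Fin.le_zero_iff.1 this]
  have hcons : ∀ l, l.Sublist ((List.finRange n).map Fin.succ) →
      (0 :: l).toFinset.sort (· ≤ ·) = 0 :: l := by
    intro l hl
    have h0 : ∀ y ∈ l, (0 : Fin (n + 1)) < y := by
      intro y hy
      obtain ⟨z, -, rfl⟩ := List.mem_map.1 (hl.subset hy)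
      exact Fin.succ_pos z
    have hlt : (0 :: l).Pairwise (· < ·) := List.pairwise_cons.2 ⟨h0, hpw.sublist hl⟩
    exact (List.toFinset_sort (· ≤ ·) (hlt.imp ne_of_lt)).2 (hlt.imp le_of_lt)
  refine Finset.sum_nbij' (fun S => (S.sort (· ≤ ·)).tail) (fun l => (0 :: l).toFinset)
    ?_ ?_ ?_ ?_ ?_
  · intro S hS
    rw [Finset.mem_filter] at hS
    rw [List.mem_toFinset, List.mem_sublists']
    have h := hsort S hS.2
    have hs : (S.sort (· ≤ ·)).Sublist (List.finRange (n + 1)) := by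
      refine List.sublist_of_subperm_of_pairwise (r := (· ≤ ·)) ?_ (S.pairwise_sort _)
        ((List.pairwise_lt_finRange _).imp le_of_lt)
      exact List.subperm_of_subset (Finset.sort_nodup _ _) fun _ _ => List.mem_finRange _
    rw [h, List.finRange_succ] at hs
    exact List.cons_sublist_cons.1 hs
  · intro l _
    simp
  · intro S hS
    rw [Finset.mem_filter] at hS
    rw [← hsort S hS.2, Finset.sort_toFinset]
  · intro l hl
    rw [List.mem_toFinset, List.mem_sublists'] at hl
    rw [hcons l hl, List.tail_cons]
  · intro S _
    rfl

theorem IsCumulantFamily.map_mul_prod {B : Subalgebra ℂ M} {E : M →ₗ[ℂ] M}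
    {κ : ∀ n : ℕ, MultilinearMap ℂ (fun _ : Fin n => M) M} (hκ : IsCumulantFamily B E κ)
    (y : M) (l : List M) :
    E (y * l.prod) = expand E (cumList κ) [] y 1 l := by
  set x : Fin (l.length + 1) → M := fun j => (y :: l)[j] with hx
  have hfn : List.ofFn x = y :: l := by
    exact List.ofFn_getElem (xs := y :: l)
  have hl : ((List.finRange l.length).map Fin.succ).map x = l := by
    have h := hfn
    rw [List.ofFn_eq_map, List.finRange_succ, List.map_cons] at h
    exact (List.cons.inj h).2
  have h := expand_eq_sum_sublists E (cumList κ) x ((List.finRange l.length).map Fin.succ)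
    [0] 0 [] (by rw [List.finRange_succ]; rfl) (by simp)
  rw [hl] at h
  have hm := hκ.moment l.length x
  rw [hfn, List.prod_cons] at hm
  rw [hm]
  simp only [List.nil_append] at h
  rw [show expand E (cumList κ) [] y 1 l =
    expand E (cumList κ) [] (x 0) ((([0] : List (Fin (l.length + 1))).filter (0 < ·)).map x).prod l
    by simp [hx], h, ← sum_finset_eq_sum_sublists]
  refine Finset.sum_congr rfl fun S _ => ?_
  by_cases hS : (0 : Fin (l.length + 1)) ∈ S
  · rw [dif_pos hS, if_pos hS]
    refine block_term_eq E κ x S hS _ ?_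
    have hmem : (0 : Fin (l.length + 1)) ∈ S.sort (· ≤ ·) := (Finset.mem_sort _).2 hS
    have hp := S.pairwise_sort (· ≤ ·)
    cases h : S.sort (· ≤ ·) with
    | nil => simp [h] at hmem
    | cons a l =>
      rw [h] at hmem hp
      rcases List.mem_cons.1 hmem with h0 | h0
      · simp [h0]
      · have := (List.pairwise_cons.1 hp).1 0 h0
        simp [Fin.le_zero_iff.1 this]
  · rw [dif_neg hS, if_neg hS]

/-- Right modularity of the cumulants in their last argument. -/
theorem IsCumulantFamily.cumList_append_mul {B : Subalgebra ℂ M} {E : M →ₗ[ℂ] M}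
    {κ : ∀ n : ℕ, MultilinearMap ℂ (fun _ : Fin n => M) M} (hκ : IsCumulantFamily B E κ)
    (hE : E 1 = 1) {b : M} (hb : ∀ x, E (x * b) = E x * b) (l : List M) (y : M) :
    cumList κ (l ++ [y * b]) = cumList κ (l ++ [y]) * b := by
  induction hN : l.length using Nat.strong_induction_on generalizing l y with
  | _ N IH =>
  have short : ∀ (l p : List M) (x u y : M), p.length + l.length + 1 < N →
      expand E (cumList κ) p x u (l ++ [y * b]) = expand E (cumList κ) p x u (l ++ [y]) * b := by
    intro l
    induction l with
    | nil =>
      intro p x u y h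
      simp only [List.nil_append, expand, add_mul]
      rw [← mul_assoc, hb, IH _ (by simp at h ⊢; omega) (p ++ [x * E u]) y rfl, hE]
      simp [mul_assoc]
    | cons z l ih =>
      intro p x u y h
      simp only [List.cons_append, expand, add_mul]
      rw [ih _ _ _ _ (by simp at h ⊢; omega), ih _ _ _ _ (by simp at h ⊢; omega)]
  have full : ∀ (l p : List M) (x y : M), p.length + l.length + 1 = N →
      expand E (cumList κ) p x 1 (l ++ [y * b]) - cumList κ (p ++ x :: (l ++ [y * b])) =
        (expand E (cumList κ) p x 1 (l ++ [y]) - cumList κ (p ++ x :: (l ++ [y]))) * b := by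
    intro l
    induction l with
    | nil =>
      intro p x y h
      simp [expand, hE, mul_assoc, hb]
    | cons z l ih =>
      intro p x y h
      have h1 := ih (p ++ [x]) z y (by simp at h ⊢; omega)
      simp only [List.append_assoc, List.singleton_append] at h1
      simp only [List.cons_append, expand, hE, mul_one, add_sub_assoc, h1]
      rw [short _ _ _ _ _ (by simp at h ⊢; omega), add_mul]
  cases l with
  | nil =>
    have h : ∀ z, cumList κ ([] ++ [z]) = E z := fun z => by
      have := hκ.map_mul_prod z []
      simpa [expand, hE] using this.symm
    rw [h, h, hb]
  | cons x l =>
    have h := full l [] x y (by simpa using hN)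
    rw [← hκ.map_mul_prod, ← hκ.map_mul_prod, List.prod_append, List.prod_append,
      List.prod_singleton, List.prod_singleton, ← mul_assoc, ← mul_assoc, ← mul_assoc, hb,
      sub_mul, sub_right_inj] at h
    simpa [mul_assoc] using h

/-- The data of a tower of conditional expectations `M → B → D`. -/
structure IsTower (B D : Subalgebra ℂ M) (E F : M →ₗ[ℂ] M) : Prop where
  le : D ≤ B
  condExp : IsCondExp B E
  map_one : F 1 = 1
  map_mem : ∀ b ∈ B, F b ∈ D
  bimod : ∀ d ∈ D, ∀ d' ∈ D, ∀ b ∈ B, F (d * b * d') = d * F b * d'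

namespace IsCondExp

variable {B : Subalgebra ℂ M} {E : M →ₗ[ℂ] M}

theorem map_left_mul (h : IsCondExp B E) {b : M} (hb : b ∈ B) (x : M) : E (b * x) = b * E x := by
  simpa using h.2.2 b hb 1 B.one_mem x

theorem map_right_mul (h : IsCondExp B E) {b : M} (hb : b ∈ B) (x : M) : E (x * b) = E x * b := by
  simpa using h.2.2 1 B.one_mem b hb x

theorem map_of_mem (h : IsCondExp B E) {b : M} (hb : b ∈ B) : E b = b := by
  simpa [h.1] using h.map_left_mul hb 1

end IsCondExp

namespace IsTower

variable {B D : Subalgebra ℂ M} {E F : M →ₗ[ℂ] M}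

theorem map_left_mul (h : IsTower B D E F) {d b : M} (hd : d ∈ D) (hb : b ∈ B) :
    F (d * b) = d * F b := by
  simpa using h.bimod d hd 1 D.one_mem b hb

theorem map_right_mul (h : IsTower B D E F) {d b : M} (hd : d ∈ D) (hb : b ∈ B) :
    F (b * d) = F b * d := by
  simpa using h.bimod 1 D.one_mem d hd b hb

theorem map_of_mem (h : IsTower B D E F) {d : M} (hd : d ∈ D) : F d = d := by
  simpa [h.map_one] using h.map_left_mul hd B.one_mem

theorem comp (h : IsTower B D E F) : IsCondExp D (F ∘ₗ E) := by
  refine ⟨by simp [h.condExp.1, h.map_one], fun x => h.map_mem _ (h.condExp.2.1 x), ?_⟩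
  intro d hd d' hd' x
  simp only [LinearMap.comp_apply]
  rw [h.condExp.2.2 d (h.le hd) d' (h.le hd') x, h.bimod d hd d' hd' _ (h.condExp.2.1 x)]

end IsTower

section Operators

variable {n : ℕ}

/-- Functionals of a partially chosen block (a list of chosen letters with the contributions of
the gaps following them, the current letter, and the product over the current gap), linear in all
gap contributions and vanishing as soon as one of the closed gaps lies in the kernel of `F`. -/
def blockFunctionals (F : M →ₗ[ℂ] M) (n : ℕ) :
    Submodule ℂ (List (Fin n × M) → Fin n → M → M) where
  carrier := {G | (∀ p i, IsLinearMap ℂ (G p i)) ∧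
    (∀ p j q i u, IsLinearMap ℂ fun β => G (p ++ (j, β) :: q) i u) ∧
    ∀ p j q i u β, F β = 0 → G (p ++ (j, β) :: q) i u = 0}
  add_mem' := by
    rintro G H ⟨hG1, hG2, hG3⟩ ⟨hH1, hH2, hH3⟩
    refine ⟨fun p i => ⟨fun u v => ?_, fun c u => ?_⟩,
      fun p j q i u => ⟨fun β γ => ?_, fun c β => ?_⟩, fun p j q i u β h => ?_⟩
    · simp only [Pi.add_apply, (hG1 p i).map_add, (hH1 p i).map_add]
      abel
    · simp only [Pi.add_apply, (hG1 p i).map_smul, (hH1 p i).map_smul, smul_add]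
    · simp only [Pi.add_apply, (hG2 p j q i u).map_add, (hH2 p j q i u).map_add]
      abel
    · simp only [Pi.add_apply, (hG2 p j q i u).map_smul, (hH2 p j q i u).map_smul, smul_add]
    · simp [hG3 p j q i u β h, hH3 p j q i u β h]
  zero_mem' := ⟨fun _ _ => ⟨by simp, by simp⟩, fun _ _ _ _ _ => ⟨by simp, by simp⟩, by simp⟩
  smul_mem' := by
    rintro a G ⟨hG1, hG2, hG3⟩
    refine ⟨fun p i => ⟨fun u v => ?_, fun c u => ?_⟩,
      fun p j q i u => ⟨fun β γ => ?_, fun c β => ?_⟩, fun p j q i u β h => ?_⟩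
    · simp only [Pi.smul_apply, (hG1 p i).map_add, smul_add]
    · simp only [Pi.smul_apply, (hG1 p i).map_smul, smul_comm a c]
    · simp only [Pi.smul_apply, (hG2 p j q i u).map_add, smul_add]
    · simp only [Pi.smul_apply, (hG2 p j q i u).map_smul, smul_comm a c]
    · simp [hG3 p j q i u β h]

/-- Right multiplication of the current gap by an element of `M`. -/
def gapAct (F : M →ₗ[ℂ] M) (n : ℕ) : M →ₐ[ℂ] Module.End ℂ (blockFunctionals F n) where
  toFun m :=
    { toFun := fun G => ⟨fun p i u => G.1 p i (u * m),
        fun p i => ⟨fun u v => by simp only [add_mul, (G.2.1 p i).map_add],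
          fun c u => by simp only [smul_mul_assoc, (G.2.1 p i).map_smul]⟩,
        fun p j q i u => G.2.2.1 p j q i (u * m), fun p j q i u β h => G.2.2.2 p j q i _ β h⟩
      map_add' := fun _ _ => rfl
      map_smul' := fun _ _ => rfl }
  map_one' := by
    ext G p i u
    simp
  map_mul' a b := by
    ext G p i u
    simp [mul_assoc]
  map_zero' := by
    ext G p i u
    simpa using (G.2.1 p i).map_zero
  map_add' a b := by
    ext G p i u
    simpa [mul_add] using (G.2.1 p i).map_add _ _
  commutes' c := by
    ext G p i u
    have h : u * algebraMap ℂ M c = c • u := by rw [← Algebra.commutes, Algebra.smul_def]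
    simpa [h, Module.algebraMap_end_apply] using (G.2.1 p i).map_smul c u

/-- Appending the letter `X j`: it either belongs to the current gap, or closes this gap and
becomes the next element of the block. -/
def varAct (E F : M →ₗ[ℂ] M) (X : Fin n → M) (j : Fin n) :
    Module.End ℂ (blockFunctionals F n) where
  toFun G := ⟨fun p i u => G.1 p i (u * X j) + G.1 (p ++ [(i, E u)]) j 1, by
    obtain ⟨G, h1, h2, h3⟩ := G
    refine ⟨fun p i => ⟨fun u v => ?_, fun c u => ?_⟩,
      fun p k q i u => ⟨fun β γ => ?_, fun c β => ?_⟩, fun p k q i u β h => ?_⟩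
    · simp only [add_mul, (h1 p i).map_add, map_add, (h2 p i [] j 1).map_add]
      abel
    · simp only [smul_mul_assoc, (h1 p i).map_smul, map_smul, (h2 p i [] j 1).map_smul, smul_add]
    · simp only [List.append_assoc, List.cons_append, (h2 p k q i _).map_add,
        (h2 p k (q ++ [(i, E u)]) j 1).map_add]
      abel
    · simp only [List.append_assoc, List.cons_append, (h2 p k q i _).map_smul,
        (h2 p k (q ++ [(i, E u)]) j 1).map_smul, smul_add]
    · simp only [List.append_assoc, List.cons_append, h3 p k q i _ β h,
        h3 p k (q ++ [(i, E u)]) j 1 β h, add_zero]⟩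
  map_add' G H := by
    ext p i u
    simp only [Submodule.coe_add, Pi.add_apply]
    abel
  map_smul' c G := by
    ext p i u
    simp

/-- Elements of `M` paired with operators on block functionals. -/
abbrev BlockOp (F : M →ₗ[ℂ] M) (n : ℕ) : Type _ := M × Module.End ℂ (blockFunctionals F n)

/-- The pair of an element of `M`, as a coefficient, and its action on gaps. -/
def baseOp (F : M →ₗ[ℂ] M) (n : ℕ) : M →ₐ[ℂ] BlockOp F n :=
  (AlgHom.id ℂ M).prod (gapAct F n)

/-- The pair of a variable and its action. -/
def varOp (E F : M →ₗ[ℂ] M) (X : Fin n → M) (j : Fin n) : BlockOp F n := (X j, varAct E F X j)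

/-- The operator of the word `X j₁ c₁ X j₂ c₂ ⋯`. -/
def tailOp (E F : M →ₗ[ℂ] M) (X : Fin n → M) : List (Fin n × M) → BlockOp F n
  | [] => 1
  | (j, c) :: l => varOp E F X j * baseOp F n c * tailOp E F X l

/-- The algebra generated by the coefficients in `C` and the variables. -/
def opAlg (E F : M →ₗ[ℂ] M) (X : Fin n → M) (C : Subalgebra ℂ M) :
    Subalgebra ℂ (BlockOp F n) :=
  Algebra.adjoin ℂ (baseOp F n '' C ∪ Set.range (varOp E F X))

/-- The arguments `X j β`. -/
def letters (X : Fin n → M) (p : List (Fin n × M)) : List M := p.map fun y => X y.1 * y.2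

variable {E F : M →ₗ[ℂ] M} {X : Fin n → M}

@[simp] theorem fst_baseOp (m : M) : (baseOp F n m).1 = m := rfl

@[simp] theorem fst_varOp (j : Fin n) : (varOp E F X j).1 = X j := rfl

@[simp] theorem snd_baseOp_apply (m : M) (G : blockFunctionals F n) (p : List (Fin n × M))
    (i : Fin n) (u : M) : ((baseOp F n m).2 G).1 p i u = G.1 p i (u * m) := rfl

@[simp] theorem snd_varOp_apply (j : Fin n) (G : blockFunctionals F n) (p : List (Fin n × M))
    (i : Fin n) (u : M) : ((varOp E F X j).2 G).1 p i u =
      G.1 p i (u * X j) + G.1 (p ++ [(i, E u)]) j 1 := rfl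

@[simp] theorem fst_tailOp (l : List (Fin n × M)) :
    (tailOp E F X l).1 = (letters X l).prod := by
  induction l with
  | nil => rfl
  | cons y l ih => simp [tailOp, letters, ih]

theorem tailOp_cons_apply (j : Fin n) (c : M) (l : List (Fin n × M)) (G : blockFunctionals F n)
    (p : List (Fin n × M)) (i : Fin n) (u : M) :
    ((tailOp E F X ((j, c) :: l)).2 G).1 p i u =
      ((tailOp E F X l).2 G).1 p i (u * (X j * c)) +
        ((tailOp E F X l).2 G).1 (p ++ [(i, E u)]) j c := by
  simp [tailOp, mul_assoc]

theorem baseOp_mem {C : Subalgebra ℂ M} {c : M} (hc : c ∈ C) : baseOp F n c ∈ opAlg E F X C :=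
  Algebra.subset_adjoin (Or.inl ⟨c, hc, rfl⟩)

theorem varOp_mem {C : Subalgebra ℂ M} (j : Fin n) : varOp E F X j ∈ opAlg E F X C :=
  Algebra.subset_adjoin (Or.inr ⟨j, rfl⟩)

theorem opAlg_mono {C C' : Subalgebra ℂ M} (h : C ≤ C') : opAlg E F X C ≤ opAlg E F X C' :=
  Algebra.adjoin_mono (Set.union_subset_union_left _ (Set.image_mono h))

theorem tailOp_mem {C : Subalgebra ℂ M} {l : List (Fin n × M)} (hl : ∀ y ∈ l, y.2 ∈ C) :
    tailOp E F X l ∈ opAlg E F X C := by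
  induction l with
  | nil => exact one_mem _
  | cons y l ih =>
    exact mul_mem (mul_mem (varOp_mem _) (baseOp_mem (hl y (by simp))))
      (ih fun z hz => hl z (by simp [hz]))

/-- The words with coefficients in `C` span the algebra they generate. -/
theorem opAlg_induction {C : Subalgebra ℂ M} {S : Submodule ℂ (BlockOp F n)}
    (h : ∀ c ∈ C, ∀ l : List (Fin n × M), (∀ y ∈ l, y.2 ∈ C) →
      baseOp F n c * tailOp E F X l ∈ S) {q : BlockOp F n} (hq : q ∈ opAlg E F X C) : q ∈ S := by
  rw [opAlg, ← Subalgebra.mem_toSubmodule, Algebra.adjoin_eq_span] at hq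
  refine Submodule.span_le.2 ?_ hq
  intro w hw
  suffices H : ∃ c ∈ C, ∃ l : List (Fin n × M), (∀ y ∈ l, y.2 ∈ C) ∧
      w = baseOp F n c * tailOp E F X l by
    obtain ⟨c, hc, l, hl, rfl⟩ := H
    exact h c hc l hl
  refine Submonoid.closure_induction_left ?_ ?_ hw
  · exact ⟨1, C.one_mem, [], by simp, by simp [tailOp]⟩
  · rintro x (⟨b, hb, rfl⟩ | ⟨j, rfl⟩) y _ ⟨c, hc, l, hl, rfl⟩
    · exact ⟨b * c, C.mul_mem hb hc, l, hl, by rw [map_mul, mul_assoc]⟩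
    · refine ⟨1, C.one_mem, (j, c) :: l, ?_, by simp [tailOp, mul_assoc]⟩
      simpa using ⟨hc, fun a b hab => hl (a, b) hab⟩

theorem exists_mem_opAlg_iff {D : Subalgebra ℂ M} {m : M} :
    m ∈ D ⊔ Algebra.adjoin ℂ (Set.range X) ↔ ∃ w ∈ opAlg E F X D, w.1 = m := by
  have h : (opAlg E F X D).map (AlgHom.fst ℂ M (Module.End ℂ (blockFunctionals F n))) =
      D ⊔ Algebra.adjoin ℂ (Set.range X) := by
    rw [opAlg, AlgHom.map_adjoin, Set.image_union, Set.image_image, ← Set.range_comp,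
      Algebra.adjoin_union]
    have h1 : (fun x => AlgHom.fst ℂ M (Module.End ℂ (blockFunctionals F n)) (baseOp F n x)) ''
      (D : Set M) = D := Set.image_id _
    rw [h1, Algebra.adjoin_eq]
    rfl
  rw [← h, Subalgebra.mem_map]
  rfl

/-- Right multiplication of the values commutes with all operators. -/
theorem apply_mul_right {C : Subalgebra ℂ M} {q : BlockOp F n} (hq : q ∈ opAlg E F X C) (c : M)
    {G H : blockFunctionals F n} (h : ∀ p i u, H.1 p i u = G.1 p i u * c)
    (p : List (Fin n × M)) (i : Fin n) (u : M) : (q.2 H).1 p i u = (q.2 G).1 p i u * c := by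
  induction hq using Algebra.adjoin_induction generalizing G H p i u with
  | mem x hx =>
    obtain ⟨b, _, rfl⟩ | ⟨j, rfl⟩ := hx
    · simp [h]
    · simp [h, add_mul]
  | algebraMap r => simp [h]
  | add x y _ _ hx hy => simp [hx h, hy h, add_mul]
  | mul x y _ _ hx hy => exact hx (hy h) p i u

/-- A kernel assigning a value to a block, multilinear in the closed gaps and vanishing if one of
them is in the kernel of `F`. -/
structure IsBlockKernel (F : M →ₗ[ℂ] M) (K : List (Fin n × M) → Fin n → M) : Prop where
  linear : ∀ p j q i, IsLinearMap ℂ fun β => K (p ++ (j, β) :: q) i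
  null : ∀ p j q i β, F β = 0 → K (p ++ (j, β) :: q) i = 0

/-- The block functional `K · E`. -/
def IsBlockKernel.functional {K : List (Fin n × M) → Fin n → M} (hK : IsBlockKernel F K)
    (E : M →ₗ[ℂ] M) : blockFunctionals F n :=
  ⟨fun p i u => K p i * E u,
    fun p i => ⟨fun u v => by simp [mul_add], fun c u => by simp⟩,
    fun p j q i u => ⟨fun β γ => by simp only [(hK.linear p j q i).map_add, add_mul],
      fun c β => by simp only [(hK.linear p j q i).map_smul, smul_mul_assoc]⟩,
    fun p j q i u β h => by simp [hK.null p j q i β h]⟩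

@[simp] theorem IsBlockKernel.functional_apply {K : List (Fin n × M) → Fin n → M}
    (hK : IsBlockKernel F K) (p : List (Fin n × M)) (i : Fin n) (u : M) :
    (hK.functional E).1 p i u = K p i * E u := rfl

/-- Conditions under which the block operators compute the expansion of `E'`-moments of words with
coefficients in `C`, when the moments of gaps are taken with `E`. -/
structure IsCompatible (X : Fin n → M) (C : Subalgebra ℂ M) (E E' : M →ₗ[ℂ] M) (U : Set M) :
    Prop where
  one_mem : 1 ∈ U
  mul_mem : ∀ u ∈ U, ∀ (j : Fin n), ∀ c ∈ C, u * (X j * c) ∈ U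
  eqOn : ∀ u ∈ U, E u = E' u
  left : ∀ c ∈ C, ∀ u, E (c * u) = c * E u
  condExp : IsCondExp C E'

namespace IsCompatible

variable {C : Subalgebra ℂ M} {E' : M →ₗ[ℂ] M} {U : Set M}
  {κ : ∀ n : ℕ, MultilinearMap ℂ (fun _ : Fin n => M) M} {K : List (Fin n × M) → Fin n → M}

theorem tailOp_eq_expand (h : IsCompatible X C E E' U) (hκ : IsCumulantFamily C E' κ)
    (hK : IsBlockKernel F K) (N : ℕ)
    (hKκ : ∀ p i, p.length + 1 < N → (∀ y ∈ p, y.2 ∈ C) →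
      K p i = cumList κ (letters X p ++ [X i]))
    (l : List (Fin n × M)) (hl : ∀ y ∈ l, y.2 ∈ C) (p : List (Fin n × M))
    (hp : ∀ y ∈ p, y.2 ∈ C) (i : Fin n) {b u : M} (hb : b ∈ C) (hu : u ∈ U)
    (hN : p.length + 1 + l.length < N) :
    ((tailOp E F X l).2 (hK.functional E)).1 p i (b * u) =
      expand E' (cumList κ) (letters X p) (X i * b) u (letters X l) := by
  induction l generalizing p i b u with
  | nil =>
    simp only [tailOp, letters, List.map_nil, expand, Prod.snd_one, Module.End.one_apply,
      IsBlockKernel.functional_apply]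
    rw [hκ.cumList_append_mul h.condExp.1 (fun x => h.condExp.map_right_mul hb x),
      hKκ p i (by simpa using hN) hp, h.left b hb, h.eqOn u hu, mul_assoc]
    rfl
  | cons y l ih =>
    obtain ⟨j, c⟩ := y
    have hc : c ∈ C := hl (j, c) (by simp)
    have hl' : ∀ y ∈ l, y.2 ∈ C := fun z hz => hl z (by simp [hz])
    have h1 := ih hl' p hp i hb (h.mul_mem u hu j c hc) (by simp at hN; omega)
    have h2 := ih hl' (p ++ [(i, E (b * u))]) (by
        intro y hy
        rcases List.mem_append.1 hy with hy | hy
        · exact hp y hy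
        · rw [List.mem_singleton.1 hy]
          simp only [h.left b hb, h.eqOn u hu]
          exact C.mul_mem hb (h.condExp.2.1 u)) j hc h.one_mem (by simp at hN ⊢; omega)
    rw [mul_one] at h2
    rw [tailOp_cons_apply, mul_assoc, h1, h2, h.left b hb, h.eqOn u hu]
    simp [letters, expand, mul_assoc]

theorem tailOp_sub_expand (h : IsCompatible X C E E' U) (hκ : IsCumulantFamily C E' κ)
    (hK : IsBlockKernel F K) (N : ℕ)
    (hKκ : ∀ p i, p.length + 1 < N → (∀ y ∈ p, y.2 ∈ C) →
      K p i = cumList κ (letters X p ++ [X i]))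
    (l : List (Fin n × M)) (hl : ∀ y ∈ l, y.2 ∈ C) (p : List (Fin n × M))
    (hp : ∀ y ∈ p, y.2 ∈ C) (i : Fin n) {b : M} (hb : b ∈ C)
    (hN : p.length + 1 + l.length = N) (p' : List (Fin n × M)) (i' : Fin n) (b' : M)
    (hpl : p ++ (i, b) :: l = p' ++ [(i', b')]) :
    ((tailOp E F X l).2 (hK.functional E)).1 p i b -
        expand E' (cumList κ) (letters X p) (X i * b) 1 (letters X l) =
      (K p' i' - cumList κ (letters X p' ++ [X i'])) * b' := by
  have hE1 : E 1 = 1 := by rw [h.eqOn 1 h.one_mem, h.condExp.1]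
  have hEb : E b = b := by simpa [hE1] using h.left b hb 1
  induction l generalizing p i b with
  | nil =>
    obtain ⟨rfl, h2⟩ := List.append_inj' hpl rfl
    obtain ⟨rfl, rfl⟩ : i = i' ∧ b = b' := by simpa using h2
    simp only [tailOp, letters, List.map_nil, expand, Prod.snd_one, Module.End.one_apply,
      IsBlockKernel.functional_apply]
    rw [hκ.cumList_append_mul h.condExp.1 (fun x => h.condExp.map_right_mul hb x),
      h.condExp.1, hEb, mul_one, sub_mul]
  | cons y l ih =>
    obtain ⟨j, c⟩ := y
    have hc : c ∈ C := hl (j, c) (by simp)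
    have hl' : ∀ y ∈ l, y.2 ∈ C := fun z hz => hl z (by simp [hz])
    have h1 := h.tailOp_eq_expand hκ hK N hKκ l hl' p hp i hb (h.mul_mem 1 h.one_mem j c hc)
      (by simp at hN; omega)
    have h2 := ih hl' (p ++ [(i, b)]) (by
        intro y hy
        rcases List.mem_append.1 hy with hy | hy
        · exact hp y hy
        · rw [List.mem_singleton.1 hy]
          exact hb) j hc (by simp at hN ⊢; omega) (by simpa using hpl)
        (by simpa [hE1] using h.left c hc 1)
    rw [← h2, tailOp_cons_apply, hEb]
    rw [one_mul] at h1
    rw [h1]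
    simp [letters, expand, h.condExp.1]

theorem apply_eq (h : IsCompatible X C E E' U) (hκ : IsCumulantFamily C E' κ)
    (hK : IsBlockKernel F K)
    (hKκ : ∀ p i, (∀ y ∈ p, y.2 ∈ C) → K p i = cumList κ (letters X p ++ [X i]))
    {q : BlockOp F n} (hq : q ∈ opAlg E F X C) (i : Fin n) :
    (q.2 (hK.functional E)).1 [] i 1 = E' (X i * q.1) := by
  let S : Submodule ℂ (BlockOp F n) :=
    { carrier := {q | (q.2 (hK.functional E)).1 [] i 1 = E' (X i * q.1)}
      add_mem' := fun {a b} ha hb => by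
        simp only [Set.mem_ofPred_eq] at ha hb ⊢
        simp [ha, hb, mul_add]
      zero_mem' := by simp
      smul_mem' := fun c a ha => by
        simp only [Set.mem_ofPred_eq] at ha ⊢
        simp [ha] }
  refine opAlg_induction (S := S) (fun c hc l hl => ?_) hq
  have h1 := h.tailOp_eq_expand hκ hK (l.length + 2) (fun p i _ => hKκ p i) l hl [] (by simp) i hc
    h.one_mem (by simp; omega)
  change ((tailOp E F X l).2 (hK.functional E)).1 [] i (1 * c) =
    E' (X i * (c * (tailOp E F X l).1))
  rw [one_mul, ← mul_one c, h1, fst_tailOp, mul_one, ← mul_assoc, hκ.map_mul_prod]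
  rfl

end IsCompatible


/-- Alternating products `b₀ p₁ b₁ ⋯ pₖ bₖ` with `pᵢ ∈ P` and `bᵢ ∈ Q`. -/
inductive Alternating {R : Type*} [Monoid R] (P Q : Set R) : ℕ → R → Prop
  | single {b : R} : b ∈ Q → Alternating P Q 0 b
  | step {k : ℕ} {v p b : R} :
      Alternating P Q k v → p ∈ P → b ∈ Q → Alternating P Q (k + 1) (v * p * b)

theorem Alternating.exists_eq_mul {R : Type*} [Monoid R] {P Q : Set R} {k : ℕ} {v : R}
    (h : Alternating P Q (k + 1) v) :
    ∃ b ∈ Q, ∃ p ∈ P, ∃ v', Alternating P Q k v' ∧ v = b * p * v' := by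
  induction k generalizing v with
  | zero =>
    cases h with
    | step hv hp hb =>
      cases hv with
      | single hb' => exact ⟨_, hb', _, hp, _, .single hb, rfl⟩
  | succ k ih =>
    cases h with
    | step hv hp hb =>
      obtain ⟨b', hb', p', hp', v', hv', rfl⟩ := ih hv
      exact ⟨b', hb', p', hp', _, hv'.step hp hb, by simp only [mul_assoc]⟩

/-- The elements of `opAlg E F X D` centered with respect to `E`. -/
def centeredOps (E F : M →ₗ[ℂ] M) (X : Fin n → M) (D : Subalgebra ℂ M) : Set (BlockOp F n) :=
  {q | q ∈ opAlg E F X D ∧ E q.1 = 0}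

/-- The coefficients in `B` centered with respect to `F`. -/
def centeredBase (F : M →ₗ[ℂ] M) (n : ℕ) (B : Subalgebra ℂ M) : Set (BlockOp F n) :=
  baseOp F n '' {b | b ∈ B ∧ F b = 0}

/-- Alternating products of centered operators and centered coefficients, beginning and ending with
a coefficient. -/
abbrev AltOp (B D : Subalgebra ℂ M) (E F : M →ₗ[ℂ] M) (X : Fin n → M) :
    ℕ → BlockOp F n → Prop :=
  Alternating (centeredOps E F X D) (centeredBase F n B)

variable {B D : Subalgebra ℂ M}

theorem IsTower.altOp_mem_opAlg (T : IsTower B D E F) {k : ℕ} {v : BlockOp F n}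
    (hv : AltOp B D E F X k v) : v ∈ opAlg E F X B := by
  induction hv with
  | single hb =>
    obtain ⟨b, hb, rfl⟩ := hb
    exact baseOp_mem hb.1
  | step _ hp hb ih =>
    obtain ⟨b, hb, rfl⟩ := hb
    exact mul_mem (mul_mem ih (opAlg_mono T.le hp.1)) (baseOp_mem hb.1)

theorem apply_eq_of_null {w : BlockOp F n} (hw : w ∈ opAlg E F X D) {v : M}
    (hv : ∀ w' ∈ opAlg E F X D, F (E (v * w'.1)) = 0) (G : blockFunctionals F n)
    (p : List (Fin n × M)) (i : Fin n) : (w.2 G).1 p i v = G.1 p i (v * w.1) := by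
  induction hw using Algebra.adjoin_induction generalizing v G with
  | mem x hx =>
    obtain ⟨b, _, rfl⟩ | ⟨j, rfl⟩ := hx
    · simp
    · rw [snd_varOp_apply, fst_varOp, G.2.2.2 p i [] j 1 (E v) (by simpa using hv 1 (one_mem _)),
        add_zero]
  | algebraMap r =>
    have h : v * algebraMap ℂ M r = r • v := by rw [← Algebra.commutes, Algebra.smul_def]
    simpa [h, Module.algebraMap_end_apply] using ((G.2.1 p i).map_smul r v).symm
  | add x y _ _ hx hy =>
    simp [hx hv, hy hv, mul_add, (G.2.1 p i).map_add]
  | mul x y hxm _ hx hy =>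
    have h := hy (v := v * x.1) (fun w' hw' => by simpa [mul_assoc] using hv _ (mul_mem hxm hw')) G
    rw [Prod.snd_mul, Module.End.mul_apply, hx hv, h, Prod.fst_mul, mul_assoc]

theorem Alternating.apply_eq {k : ℕ} {v : BlockOp F n} (hv : AltOp B D E F X k v) {u : M}
    (hu : ∀ k' ≤ k, ∀ v', AltOp B D E F X k' v' → ∀ w ∈ opAlg E F X D,
      F (E (u * v'.1 * w.1)) = 0) (G : blockFunctionals F n)
    (p : List (Fin n × M)) (i : Fin n) : (v.2 G).1 p i u = G.1 p i (u * v.1) := by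
  induction hv generalizing G with
  | single hb =>
    obtain ⟨b, hb, rfl⟩ := hb
    rfl
  | @step k v q c hv hq hb ih =>
    obtain ⟨b, hb, rfl⟩ := hb
    rw [Prod.snd_mul, Prod.snd_mul, Module.End.mul_apply, Module.End.mul_apply,
      ih (fun k' hk' => hu k' (by omega)),
      apply_eq_of_null hq.1 (fun w hw => hu k (by omega) v hv w hw)]
    simp [mul_assoc]

/-- All the centered alternating products of length at most `k`, multiplied by `u`, are centered. -/
def Annihilates (B D : Subalgebra ℂ M) (E F : M →ₗ[ℂ] M) (X : Fin n → M) (u : M) (k : ℕ) : Prop :=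
  ∀ k' ≤ k, ∀ v, AltOp B D E F X k' v → ∀ q ∈ centeredOps E F X D, E (u * v.1 * q.1) = 0

theorem IsTower.exists_eq_add_baseOp (T : IsTower B D E F)
    (hD : ∀ w ∈ opAlg E F X D, E w.1 ∈ D) {w : BlockOp F n} (hw : w ∈ opAlg E F X D) :
    ∃ q ∈ centeredOps E F X D, ∃ d ∈ D, w = q + baseOp F n d := by
  refine ⟨w + baseOp F n (-E w.1), ⟨add_mem hw (baseOp_mem (D.neg_mem (hD w hw))), ?_⟩,
    E w.1, hD w hw, ?_⟩
  · simp [T.condExp.map_of_mem (T.le (hD w hw))]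
  · rw [add_assoc, ← map_add, neg_add_cancel, map_zero, add_zero]

theorem Annihilates.map_eq_zero (T : IsTower B D E F) (hD : ∀ w ∈ opAlg E F X D, E w.1 ∈ D)
    {u : M} (hu : E u ∈ D) {k : ℕ} (h : Annihilates B D E F X u k) {k' : ℕ} (hk : k' ≤ k)
    {v : BlockOp F n} (hv : AltOp B D E F X k' v) {w : BlockOp F n} (hw : w ∈ opAlg E F X D) :
    F (E (u * v.1 * w.1)) = 0 := by
  obtain ⟨q, hq, d, hd, rfl⟩ := T.exists_eq_add_baseOp hD hw
  rw [Prod.fst_add, fst_baseOp, mul_add, map_add, h k' hk v hv q hq, zero_add,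
    T.condExp.map_right_mul (T.le hd), T.map_right_mul hd (T.condExp.2.1 _)]
  suffices H : F (E (u * v.1)) = 0 by rw [H, zero_mul]
  cases hv with
  | single hb =>
    obtain ⟨b, hb, rfl⟩ := hb
    rw [fst_baseOp, T.condExp.map_right_mul hb.1, T.map_left_mul hu hb.1, hb.2, mul_zero]
  | step hv hq hb =>
    obtain ⟨b, hb, rfl⟩ := hb
    rw [Prod.fst_mul, Prod.fst_mul, fst_baseOp, ← mul_assoc, T.condExp.map_right_mul hb.1,
      ← mul_assoc, h _ (by omega) _ hv _ hq, zero_mul, map_zero]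

theorem Annihilates.apply_mul (T : IsTower B D E F) (hD : ∀ w ∈ opAlg E F X D, E w.1 ∈ D)
    {u : M} (hu : E u ∈ D) {k : ℕ} (h : Annihilates B D E F X u k)
    {v : BlockOp F n} (hv : AltOp B D E F X k v) {q : BlockOp F n}
    (hq : q ∈ centeredOps E F X D) {K : List (Fin n × M) → Fin n → M} (hK : IsBlockKernel F K)
    (p : List (Fin n × M)) (i : Fin n) : ((v * q).2 (hK.functional E)).1 p i u = 0 := by
  rw [Prod.snd_mul, Module.End.mul_apply,
    hv.apply_eq (fun k' hk' v' hv' w hw => h.map_eq_zero T hD hu hk' hv' hw),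
    apply_eq_of_null hq.1 (fun w hw => h.map_eq_zero T hD hu le_rfl hv hw),
    IsBlockKernel.functional_apply, h k le_rfl v hv q hq, mul_zero]

/-- The words of length at most `m` in the variables with coefficients in `D`. -/
def words (X : Fin n → M) (D : Subalgebra ℂ M) (m : ℕ) : Set M :=
  {u | ∃ c ∈ D, ∃ l : List (Fin n × M), l.length ≤ m ∧ (∀ y ∈ l, y.2 ∈ D) ∧
    u = c * (letters X l).prod}

theorem mem_words {c : M} (hc : c ∈ D) (m : ℕ) : c ∈ words X D m :=
  ⟨c, hc, [], by simp, by simp, by simp [letters]⟩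

theorem mul_mem_words {m : ℕ} {u : M} (hu : u ∈ words X D m) (j : Fin n) {c : M} (hc : c ∈ D) :
    u * (X j * c) ∈ words X D (m + 1) := by
  obtain ⟨b, hb, l, hlm, hl, rfl⟩ := hu
  refine ⟨b, hb, l ++ [(j, c)], by simpa using hlm, ?_, by simp [letters, mul_assoc]⟩
  intro y hy
  rcases List.mem_append.1 hy with hy | hy
  · exact hl y hy
  · rwa [List.mem_singleton.1 hy]

theorem exists_mem_opAlg_of_mem_words {m : ℕ} {u : M} (hu : u ∈ words X D m) :
    ∃ w ∈ opAlg E F X D, w.1 = u := by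
  obtain ⟨b, hb, l, hlm, hl, rfl⟩ := hu
  exact ⟨baseOp F n b * tailOp E F X l, mul_mem (baseOp_mem hb) (tailOp_mem hl), by simp⟩

theorem tailOp_apply_mem (S : Submodule ℂ M) {N : ℕ} {G : blockFunctionals F n}
    (hG : ∀ p i, ∀ u ∈ words X D N, G.1 p i u ∈ S) (l : List (Fin n × M))
    (hl : ∀ y ∈ l, y.2 ∈ D) {m : ℕ} (hm : m + l.length = N) {u : M} (hu : u ∈ words X D m)
    (p : List (Fin n × M)) (i : Fin n) : ((tailOp E F X l).2 G).1 p i u ∈ S := by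
  induction l generalizing m u p i with
  | nil =>
    obtain rfl : m = N := by simpa using hm
    exact hG p i u hu
  | cons y l ih =>
    obtain ⟨j, c⟩ := y
    have hc : c ∈ D := hl (j, c) (by simp)
    have hl' : ∀ y ∈ l, y.2 ∈ D := fun z hz => hl z (by simp [hz])
    have hm' : m + 1 + l.length = N := by simp at hm; omega
    rw [tailOp_cons_apply]
    exact S.add_mem (ih hl' hm' (mul_mem_words hu j hc) p i) (ih hl' hm' (mem_words hc _) _ j)

section Kernel

variable {κ : ∀ n : ℕ, MultilinearMap ℂ (fun _ : Fin n => M) M} {K : List (Fin n × M) → Fin n → M}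

theorem IsTower.isCompatible (T : IsTower B D E F) : IsCompatible X B E E Set.univ :=
  ⟨trivial, fun _ _ _ _ _ => trivial, fun _ _ => rfl, fun _ hc u => T.condExp.map_left_mul hc u,
    T.condExp⟩

/-- The value of `E` on a word, followed by `q`, is computed by a shorter word acting on a
functional. -/
theorem IsTower.map_cons (T : IsTower B D E F) (hκ : IsCumulantFamily B E κ)
    (hK : IsBlockKernel F K)
    (hKκ : ∀ p i, (∀ y ∈ p, y.2 ∈ B) → K p i = cumList κ (letters X p ++ [X i]))
    {b c : M} (hb : b ∈ B) (hc : c ∈ B) {l : List (Fin n × M)} (hl : ∀ y ∈ l, y.2 ∈ B)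
    {q : BlockOp F n} (hq : q ∈ opAlg E F X B) (i : Fin n) :
    E (b * (letters X ((i, c) :: l)).prod * q.1) =
      b * ((tailOp E F X l).2 (q.2 (hK.functional E))).1 [] i c := by
  have h := T.isCompatible.apply_eq hκ hK hKκ
    (mul_mem (mul_mem (baseOp_mem hc) (tailOp_mem hl)) hq) i
  rw [mul_assoc, T.condExp.map_left_mul hb]
  congr 1
  simp only [Prod.snd_mul, Prod.fst_mul, Module.End.mul_apply, snd_baseOp_apply, one_mul,
    fst_baseOp, fst_tailOp] at h
  rw [h]
  simp [letters, mul_assoc]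

theorem IsTower.map_mem_of_kernel (T : IsTower B D E F) (hκ : IsCumulantFamily B E κ)
    (hK : IsBlockKernel F K)
    (hKκ : ∀ p i, (∀ y ∈ p, y.2 ∈ B) → K p i = cumList κ (letters X p ++ [X i]))
    (hKD : ∀ p i, K p i ∈ D) {w : BlockOp F n} (hw : w ∈ opAlg E F X D) : E w.1 ∈ D := by
  have key : ∀ m : ℕ, ∀ u ∈ words X D m, E u ∈ D := by
    intro m
    induction m with
    | zero =>
      rintro u ⟨c, hc, l, hlm, hl, rfl⟩
      obtain rfl : l = [] := by simpa using hlm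
      simpa [letters, T.condExp.map_of_mem (T.le hc)] using hc
    | succ m ih =>
      rintro u ⟨c, hc, l, hlm, hl, rfl⟩
      cases l with
      | nil => simpa [letters, T.condExp.map_of_mem (T.le hc)] using hc
      | cons y l =>
        obtain ⟨j, c'⟩ := y
        have hc' : c' ∈ D := hl (j, c') (by simp)
        have hl' : ∀ y ∈ l, y.2 ∈ D := fun z hz => hl z (by simp [hz])
        have h := T.map_cons hκ hK hKκ (T.le hc) (T.le hc') (fun y hy => T.le (hl' y hy))
          (one_mem _) j
        rw [Prod.fst_one, mul_one] at h
        rw [h]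
        refine D.mul_mem hc (tailOp_apply_mem (Subalgebra.toSubmodule D) (N := m) ?_ l hl'
          (m := m - l.length) (by simp at hlm; omega) (mem_words hc' _) [] j)
        intro p i u hu
        exact D.mul_mem (hKD p i) (ih u hu)
  let S : Submodule ℂ (BlockOp F n) :=
    (Subalgebra.toSubmodule D).comap (E ∘ₗ LinearMap.fst ℂ M _)
  refine opAlg_induction (S := S) (fun c hc l hl => ?_) hw
  exact key l.length _ ⟨c, hc, l, le_rfl, hl, by simp⟩

theorem IsTower.annihilates_of_kernel (T : IsTower B D E F) (hκ : IsCumulantFamily B E κ)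
    (hK : IsBlockKernel F K)
    (hKκ : ∀ p i, (∀ y ∈ p, y.2 ∈ B) → K p i = cumList κ (letters X p ++ [X i]))
    (hKD : ∀ p i, K p i ∈ D) {w : BlockOp F n} (hw : w ∈ opAlg E F X D) (k : ℕ) :
    Annihilates B D E F X w.1 k := by
  have hD : ∀ w ∈ opAlg E F X D, E w.1 ∈ D := fun w hw => T.map_mem_of_kernel hκ hK hKκ hKD hw
  induction k using Nat.strong_induction_on generalizing w with
  | _ k IH =>
  have base : ∀ v, AltOp B D E F X k v → ∀ q ∈ centeredOps E F X D, E (v.1 * q.1) = 0 := by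
    intro v hv q hq
    cases k with
    | zero =>
      cases hv with
      | single hb =>
        obtain ⟨b, hb, rfl⟩ := hb
        rw [fst_baseOp, T.condExp.map_left_mul hb.1, hq.2, mul_zero]
    | succ k =>
      obtain ⟨_, ⟨b, hb, rfl⟩, p, hp, v', hv', rfl⟩ := hv.exists_eq_mul
      rw [Prod.fst_mul, Prod.fst_mul, fst_baseOp, mul_assoc, mul_assoc,
        T.condExp.map_left_mul hb.1, ← mul_assoc,
        IH k (by omega) hp.1 k le_rfl v' hv' q hq, mul_zero]
  have key : ∀ m : ℕ, ∀ u ∈ words X D m, ∀ v, AltOp B D E F X k v →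
      ∀ q ∈ centeredOps E F X D, E (u * v.1 * q.1) = 0 := by
    intro m
    induction m with
    | zero =>
      rintro u ⟨c, hc, l, hlm, hl, rfl⟩ v hv q hq
      obtain rfl : l = [] := by simpa using hlm
      rw [letters, List.map_nil, List.prod_nil, mul_one, mul_assoc,
        T.condExp.map_left_mul (T.le hc), base v hv q hq, mul_zero]
    | succ m ih =>
      rintro u ⟨c, hc, l, hlm, hl, rfl⟩ v hv q hq
      cases l with
      | nil =>
        rw [letters, List.map_nil, List.prod_nil, mul_one, mul_assoc,
          T.condExp.map_left_mul (T.le hc), base v hv q hq, mul_zero]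
      | cons y l =>
        obtain ⟨j, c'⟩ := y
        have hc' : c' ∈ D := hl (j, c') (by simp)
        have hl' : ∀ y ∈ l, y.2 ∈ D := fun z hz => hl z (by simp [hz])
        have h := T.map_cons hκ hK hKκ (T.le hc) (T.le hc') (fun y hy => T.le (hl' y hy))
          (mul_mem (T.altOp_mem_opAlg hv) (opAlg_mono T.le hq.1)) j
        rw [Prod.fst_mul, ← mul_assoc] at h
        rw [h]
        have h0 : ((tailOp E F X l).2 ((v * q).2 (hK.functional E))).1 [] j c' = 0 := by
          rw [← Submodule.mem_bot ℂ]
          refine tailOp_apply_mem ⊥ (N := m) ?_ l hl' (m := m - l.length)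
            (by simp at hlm; omega) (mem_words hc' _) [] j
          intro p i u hu
          obtain ⟨w', hw', rfl⟩ := exists_mem_opAlg_of_mem_words (E := E) (F := F) hu
          rw [Submodule.mem_bot]
          refine Annihilates.apply_mul T hD (hD w' hw') ?_ hv hq hK p i
          intro k' hk' v' hv' q' hq'
          rcases hk'.lt_or_eq with hk' | rfl
          · exact IH k' hk' hw' k' le_rfl v' hv' q' hq'
          · exact ih _ hu v' hv' q' hq'
        rw [h0, mul_zero]
  intro k' hk' v hv q hq
  rcases hk'.lt_or_eq with hk' | rfl
  · exact IH k' hk' hw k' le_rfl v hv q hq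
  let S : Submodule ℂ (BlockOp F n) :=
    (E ∘ₗ LinearMap.mulRight ℂ (v.1 * q.1) ∘ₗ LinearMap.fst ℂ M _).ker
  have hS : w ∈ S := opAlg_induction (fun c hc l hl => by
    simpa [S, mul_assoc] using key l.length _ ⟨c, hc, l, le_rfl, hl, rfl⟩ v hv q hq) hw
  simpa [S, mul_assoc] using hS

end Kernel

/-- The span of `opAlg E F X D` and of the products `w v w'` with `w` and `w'` in this algebra and
`v` a centered alternating product. -/
def alternatingSpan (B D : Subalgebra ℂ M) (E F : M →ₗ[ℂ] M) (X : Fin n → M) :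
    Submodule ℂ (BlockOp F n) :=
  Submodule.span ℂ (opAlg E F X D ∪
    {q | ∃ w ∈ opAlg E F X D, ∃ k v, AltOp B D E F X k v ∧ ∃ w' ∈ opAlg E F X D, q = w * v * w'})

theorem mem_alternatingSpan {w : BlockOp F n} (hw : w ∈ opAlg E F X D) :
    w ∈ alternatingSpan B D E F X :=
  Submodule.subset_span (Or.inl hw)

theorem mul_mul_mem_alternatingSpan {w v w' : BlockOp F n} (hw : w ∈ opAlg E F X D) {k : ℕ}
    (hv : AltOp B D E F X k v) (hw' : w' ∈ opAlg E F X D) :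
    w * v * w' ∈ alternatingSpan B D E F X :=
  Submodule.subset_span (Or.inr ⟨w, hw, k, v, hv, w', hw', rfl⟩)

theorem IsTower.baseOp_eq (T : IsTower B D E F) {b : M} (hb : b ∈ B) :
    ∃ q ∈ centeredBase F n B, baseOp F n b = q + baseOp F n (F b) := by
  refine ⟨baseOp F n (b - F b), ⟨b - F b, ⟨B.sub_mem hb (T.le (T.map_mem b hb)), ?_⟩, rfl⟩, ?_⟩
  · rw [map_sub, T.map_of_mem (T.map_mem b hb), sub_self]
  · rw [← map_add, sub_add_cancel]

theorem IsTower.mul_baseOp_mem_alternatingSpan (T : IsTower B D E F)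
    (hD : ∀ w ∈ opAlg E F X D, E w.1 ∈ D) {z : BlockOp F n}
    (hz : z ∈ alternatingSpan B D E F X) {b : M} (hb : b ∈ B) :
    z * baseOp F n b ∈ alternatingSpan B D E F X := by
  have h1 : ∀ w ∈ opAlg E F X D, ∀ b ∈ B, w * baseOp F n b ∈ alternatingSpan B D E F X := by
    intro w hw b hb
    obtain ⟨q, hq, h⟩ := T.baseOp_eq (n := n) hb
    rw [h, mul_add]
    refine add_mem ?_ (mem_alternatingSpan (mul_mem hw (baseOp_mem (T.map_mem b hb))))
    simpa using mul_mul_mem_alternatingSpan hw (.single hq) (one_mem _)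
  have h2 : ∀ w ∈ opAlg E F X D, ∀ k v, AltOp B D E F X k v → ∀ q ∈ centeredOps E F X D,
      ∀ b ∈ B, w * v * q * baseOp F n b ∈ alternatingSpan B D E F X := by
    intro w hw k v hv q hq b hb
    obtain ⟨r, hr, h⟩ := T.baseOp_eq (n := n) hb
    rw [h, mul_add]
    refine add_mem ?_ ?_
    · simpa [mul_assoc] using mul_mul_mem_alternatingSpan hw (hv.step hq hr) (one_mem _)
    · rw [mul_assoc]
      exact mul_mul_mem_alternatingSpan hw hv (mul_mem hq.1 (baseOp_mem (T.map_mem b hb)))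
  have h3 : ∀ w ∈ opAlg E F X D, ∀ k v, AltOp B D E F X k v →
      ∀ b ∈ B, w * v * baseOp F n b ∈ alternatingSpan B D E F X := by
    intro w hw k v hv b hb
    cases hv with
    | single hc =>
      obtain ⟨c, hc, rfl⟩ := hc
      rw [mul_assoc, ← map_mul]
      exact h1 w hw _ (B.mul_mem hc.1 hb)
    | step hv hq hc =>
      obtain ⟨c, hc, rfl⟩ := hc
      have h := h2 w hw _ _ hv _ hq _ (B.mul_mem hc.1 hb)
      simpa only [map_mul, mul_assoc] using h
  refine Submodule.span_induction (p := fun z _ => z * baseOp F n b ∈ alternatingSpan B D E F X)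
    ?_ (by simp) (fun x y _ _ hx hy => by rw [add_mul]; exact add_mem hx hy)
    (fun c x _ hx => by rw [smul_mul_assoc]; exact Submodule.smul_mem _ c hx) hz
  rintro z (hz | ⟨w, hw, k, v, hv, w', hw', rfl⟩)
  · exact h1 z hz b hb
  · obtain ⟨q, hq, d, hd, rfl⟩ := T.exists_eq_add_baseOp hD hw'
    rw [mul_add, add_mul]
    refine add_mem (h2 w hw k v hv q hq b hb) ?_
    rw [mul_assoc, ← map_mul]
    exact h3 w hw k v hv _ (B.mul_mem (T.le hd) hb)

theorem mul_varOp_mem_alternatingSpan {z : BlockOp F n}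
    (hz : z ∈ alternatingSpan B D E F X) (j : Fin n) :
    z * varOp E F X j ∈ alternatingSpan B D E F X := by
  refine Submodule.span_induction (p := fun z _ => z * varOp E F X j ∈ alternatingSpan B D E F X)
    ?_ (by simp) (fun x y _ _ hx hy => by rw [add_mul]; exact add_mem hx hy)
    (fun c x _ hx => by rw [smul_mul_assoc]; exact Submodule.smul_mem _ c hx) hz
  rintro z (hz | ⟨w, hw, k, v, hv, w', hw', rfl⟩)
  · exact mem_alternatingSpan (mul_mem hz (varOp_mem j))
  · rw [mul_assoc]
    exact mul_mul_mem_alternatingSpan hw hv (mul_mem hw' (varOp_mem j))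

theorem IsTower.mem_alternatingSpan (T : IsTower B D E F)
    (hD : ∀ w ∈ opAlg E F X D, E w.1 ∈ D) {q : BlockOp F n} (hq : q ∈ opAlg E F X B) :
    q ∈ alternatingSpan B D E F X := by
  suffices h : ∀ z ∈ alternatingSpan B D E F X, z * q ∈ alternatingSpan B D E F X by
    simpa using h 1 (OVD.mem_alternatingSpan (one_mem _))
  induction hq using Algebra.adjoin_induction with
  | mem x hx =>
    intro z hz
    obtain ⟨b, hb, rfl⟩ | ⟨j, rfl⟩ := hx
    · exact T.mul_baseOp_mem_alternatingSpan hD hz hb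
    · exact mul_varOp_mem_alternatingSpan hz j
  | algebraMap r =>
    intro z hz
    rw [← Algebra.commutes, ← Algebra.smul_def]
    exact Submodule.smul_mem _ r hz
  | add x y _ _ hx hy =>
    intro z hz
    rw [mul_add]
    exact add_mem (hx z hz) (hy z hz)
  | mul x y _ _ hx hy =>
    intro z hz
    rw [← mul_assoc]
    exact hy _ (hx z hz)

theorem apply_eq_zero {w : BlockOp F n} (hw : w ∈ opAlg E F X D) {G : blockFunctionals F n}
    (hG : ∀ p i, ∀ w' ∈ opAlg E F X D, G.1 p i w'.1 = 0) (p : List (Fin n × M)) (i : Fin n)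
    {w' : BlockOp F n} (hw' : w' ∈ opAlg E F X D) : (w.2 G).1 p i w'.1 = 0 := by
  induction hw using Algebra.adjoin_induction generalizing G p i w' with
  | mem x hx =>
    obtain ⟨b, hb, rfl⟩ | ⟨j, rfl⟩ := hx
    · exact hG p i _ (mul_mem hw' (baseOp_mem hb))
    · rw [snd_varOp_apply]
      have h1 := hG p i _ (mul_mem hw' (varOp_mem j))
      have h2 := hG (p ++ [(i, E w'.1)]) j 1 (one_mem _)
      rw [Prod.fst_mul, fst_varOp] at h1
      rw [Prod.fst_one] at h2
      rw [h1, h2, add_zero]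
  | algebraMap r => simp [Module.algebraMap_end_apply, hG p i w' hw']
  | add x y _ _ hx hy => simp [hx hG p i hw', hy hG p i hw']
  | mul x y _ _ hx hy => exact hx (fun p i w' hw' => hy hG p i hw') p i hw'

section Kernel

variable {κB κD : ∀ n : ℕ, MultilinearMap ℂ (fun _ : Fin n => M) M}
  {K : List (Fin n × M) → Fin n → M}

theorem IsTower.isCompatible_comp (T : IsTower B D E F) (hD : ∀ w ∈ opAlg E F X D, E w.1 ∈ D) :
    IsCompatible X D E (F ∘ₗ E) (Prod.fst '' (opAlg E F X D : Set (BlockOp F n))) where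
  one_mem := ⟨1, one_mem _, rfl⟩
  mul_mem := by
    rintro _ ⟨w, hw, rfl⟩ j c hc
    exact ⟨w * (varOp E F X j * baseOp F n c), mul_mem hw (mul_mem (varOp_mem j) (baseOp_mem hc)),
      rfl⟩
  eqOn := by
    rintro _ ⟨w, hw, rfl⟩
    exact (T.map_of_mem (hD w hw)).symm
  left c hc u := T.condExp.map_left_mul (T.le hc) u
  condExp := T.comp

theorem IsTower.apply_eq_of_annihilates (T : IsTower B D E F)
    (hD : ∀ w ∈ opAlg E F X D, E w.1 ∈ D)
    (hA : ∀ w ∈ opAlg E F X D, ∀ k, Annihilates B D E F X w.1 k)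
    (hκ : IsCumulantFamily D (F ∘ₗ E) κD) (hK : IsBlockKernel F K)
    (hKκ : ∀ p i, (∀ y ∈ p, y.2 ∈ D) → K p i = cumList κD (letters X p ++ [X i]))
    {q : BlockOp F n} (hq : q ∈ opAlg E F X B) (i : Fin n) :
    (q.2 (hK.functional E)).1 [] i 1 = E (X i * q.1) := by
  have h1 : ∀ w ∈ opAlg E F X D, (w.2 (hK.functional E)).1 [] i 1 = E (X i * w.1) := by
    intro w hw
    rw [(T.isCompatible_comp hD).apply_eq hκ hK hKκ hw i, LinearMap.comp_apply]
    exact T.map_of_mem (hD _ (mul_mem (varOp_mem i) hw))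
  have h2 : ∀ w ∈ opAlg E F X D, ∀ k v, AltOp B D E F X k v → ∀ q ∈ centeredOps E F X D,
      ((w * v * q).2 (hK.functional E)).1 [] i 1 = E (X i * (w * v * q).1) := by
    intro w hw k v hv q hq
    have h := hA _ (mul_mem (varOp_mem i) hw) k k le_rfl v hv q hq
    simp only [Prod.fst_mul, fst_varOp, mul_assoc] at h ⊢
    rw [h, Prod.snd_mul, Module.End.mul_apply]
    exact apply_eq_zero (E := E) (X := X) hw
      (fun p i w' hw' => (hA w' hw' k).apply_mul T hD (hD w' hw') hv hq hK p i) [] i (one_mem _)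
  have h3 : ∀ q ∈ opAlg E F X B, (q.2 (hK.functional E)).1 [] i 1 = E (X i * q.1) →
      ∀ b ∈ B, ((q * baseOp F n b).2 (hK.functional E)).1 [] i 1 =
        E (X i * (q * baseOp F n b).1) := by
    intro q hq h b hb
    rw [Prod.snd_mul, Module.End.mul_apply, apply_mul_right hq b (G := hK.functional E)
      (fun p i u => by simp [T.condExp.map_right_mul hb, mul_assoc]), h, Prod.fst_mul,
      fst_baseOp, ← mul_assoc, T.condExp.map_right_mul hb]
  have h4 : ∀ w ∈ opAlg E F X D, ∀ k v, AltOp B D E F X k v →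
      ((w * v).2 (hK.functional E)).1 [] i 1 = E (X i * (w * v).1) := by
    intro w hw k v hv
    have hwB := opAlg_mono T.le hw
    cases hv with
    | single hb =>
      obtain ⟨b, hb, rfl⟩ := hb
      exact h3 w hwB (h1 w hw) b hb.1
    | step hv hq hb =>
      obtain ⟨b, hb, rfl⟩ := hb
      rw [← mul_assoc, ← mul_assoc]
      exact h3 _ (mul_mem (mul_mem hwB (T.altOp_mem_opAlg hv)) (opAlg_mono T.le hq.1))
        (h2 w hw _ _ hv _ hq) b hb.1
  refine Submodule.span_induction
    (p := fun q _ => (q.2 (hK.functional E)).1 [] i 1 = E (X i * q.1))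
    ?_ (by simp) (fun x y _ _ hx hy => by simp [hx, hy, mul_add])
    (fun c x _ hx => by simp [hx]) (T.mem_alternatingSpan hD hq)
  rintro z (hz | ⟨w, hw, k, v, hv, w', hw', rfl⟩)
  · exact h1 z hz
  · obtain ⟨q, hq, d, hd, rfl⟩ := T.exists_eq_add_baseOp hD hw'
    have e1 := h2 w hw k v hv q hq
    have e2 := h3 _ (mul_mem (opAlg_mono T.le hw) (T.altOp_mem_opAlg hv)) (h4 w hw k v hv) d
      (T.le hd)
    rw [mul_add, Prod.snd_add, Prod.fst_add, mul_add, map_add, ← e1, ← e2]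
    rfl

theorem IsTower.kernel_eq_of_annihilates (T : IsTower B D E F)
    (hD : ∀ w ∈ opAlg E F X D, E w.1 ∈ D)
    (hA : ∀ w ∈ opAlg E F X D, ∀ k, Annihilates B D E F X w.1 k)
    (hκB : IsCumulantFamily B E κB)
    (hκ : IsCumulantFamily D (F ∘ₗ E) κD) (hK : IsBlockKernel F K)
    (hKκ : ∀ p i, (∀ y ∈ p, y.2 ∈ D) → K p i = cumList κD (letters X p ++ [X i]))
    (p : List (Fin n × M)) (i : Fin n) (hp : ∀ y ∈ p, y.2 ∈ B) :
    K p i = cumList κB (letters X p ++ [X i]) := by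
  induction hN : p.length using Nat.strong_induction_on generalizing p i with
  | _ N IH =>
  obtain ⟨i₀, b₀, l, hl, hb₀, hpl⟩ : ∃ (i₀ : Fin n) (b₀ : M) (l : List (Fin n × M)),
      (∀ y ∈ l, y.2 ∈ B) ∧ b₀ ∈ B ∧ p ++ [(i, 1)] = (i₀, b₀) :: l := by
    cases p with
    | nil => exact ⟨i, 1, [], by simp, B.one_mem, rfl⟩
    | cons y p =>
      refine ⟨y.1, y.2, p ++ [(i, 1)], ?_, hp y (by simp), rfl⟩
      intro z hz
      rcases List.mem_append.1 hz with hz | hz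
      · exact hp z (by simp [hz])
      · rw [List.mem_singleton.1 hz]
        exact B.one_mem
  have hlen : p.length + 1 = l.length + 1 := by
    simpa using congrArg List.length hpl
  have h1 := T.isCompatible.tailOp_sub_expand hκB hK (N + 1)
    (fun p i hlt hp => IH _ (by omega) p i hp rfl) l hl [] (by simp) i₀ hb₀
    (by simp; omega) p i 1 hpl.symm
  have h2 := T.apply_eq_of_annihilates hD hA hκ hK hKκ
    (mul_mem (baseOp_mem hb₀) (tailOp_mem hl)) i₀
  simp only [Prod.snd_mul, Prod.fst_mul, Module.End.mul_apply, snd_baseOp_apply, one_mul,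
    fst_baseOp, fst_tailOp] at h2
  rw [h2, ← mul_assoc, hκB.map_mul_prod, mul_one] at h1
  exact (sub_eq_zero.1 (h1.symm.trans (sub_self _)))

end Kernel

/-- Nonempty products of elements taken alternately from `S true` and `S false`, indexed by the
origin of the last factor. -/
inductive AltProd {A : Type*} [Monoid A] (S : Bool → Set A) : Bool → A → Prop
  | single {e : Bool} {m : A} : m ∈ S e → AltProd S e m
  | snoc {e : Bool} {v m : A} : AltProd S e v → m ∈ S (!e) → AltProd S (!e) (v * m)

theorem AltProd.exists_ofFn {A : Type*} [Monoid A] {S : Bool → Set A} {e : Bool} {m : A}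
    (h : AltProd S e m) : ∃ (k : ℕ) (a : Fin (k + 1) → A) (f : Fin (k + 1) → Bool),
      (∀ j, a j ∈ S (f j)) ∧ (∀ j : Fin k, f j.castSucc ≠ f j.succ) ∧ f (Fin.last k) = e ∧
      (List.ofFn a).prod = m := by
  induction h with
  | @single e m hm => exact ⟨0, fun _ => m, fun _ => e, fun _ => hm, fun j => j.elim0, rfl, by simp⟩
  | @snoc e v m _ hm ih =>
    obtain ⟨k, a, f, ha, hf, hlast, rfl⟩ := ih
    refine ⟨k + 1, Fin.snoc a m, Fin.snoc f !e, fun j => ?_, fun j => ?_, by simp, ?_⟩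
    · refine Fin.lastCases ?_ (fun j => ?_) j
      · simpa using hm
      · simpa using ha j
    · refine Fin.lastCases ?_ (fun j => ?_) j
      · rw [Fin.succ_last, Fin.snoc_last, Fin.snoc_castSucc, hlast]
        simp
      · rw [Fin.succ_castSucc, Fin.snoc_castSucc, Fin.snoc_castSucc]
        exact hf j
    · rw [List.ofFn_succ', List.prod_concat]
      simp only [Fin.snoc_castSucc, Fin.snoc_last]

theorem altProd_ofFn {A : Type*} [Monoid A] {S : Bool → Set A} {k : ℕ} (a : Fin (k + 1) → A)
    (f : Fin (k + 1) → Bool) (ha : ∀ j, a j ∈ S (f j))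
    (hf : ∀ j : Fin k, f j.castSucc ≠ f j.succ) :
    AltProd S (f (Fin.last k)) (List.ofFn a).prod := by
  induction k with
  | zero => simpa using AltProd.single (ha 0)
  | succ k ih =>
    rw [List.ofFn_succ', List.prod_concat]
    have h := ih (fun j => a j.castSucc) (fun j => f j.castSucc) (fun j => ha _)
      (fun j => hf j.castSucc)
    have e : f (Fin.last (k + 1)) = !f (Fin.last k).castSucc :=
      (Bool.eq_not_of_ne (hf (Fin.last k)).symm)
    have hm := ha (Fin.last (k + 1))
    rw [e] at hm ⊢
    exact h.snoc hm

/-- The centered elements of the two sets, the first one being indexed by `true`. -/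
def centered {A W : Type*} [Ring A] [Algebra ℂ A] [AddCommGroup W] [Module ℂ W] (φ : A →ₗ[ℂ] W)
    (S₁ S₂ : Set A) (e : Bool) : Set A :=
  {m | (m ∈ if e then S₁ else S₂) ∧ φ m = 0}

theorem isFreeWithAmalgamation_iff {A W : Type*} [Ring A] [Algebra ℂ A] [AddCommGroup W]
    [Module ℂ W] {φ : A →ₗ[ℂ] W} {S₁ S₂ : Set A} :
    IsFreeWithAmalgamation φ S₁ S₂ ↔ ∀ e m, AltProd (centered φ S₁ S₂) e m → φ m = 0 := by
  constructor
  · intro h e m hm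
    obtain ⟨k, a, f, ha, hf, -, rfl⟩ := hm.exists_ofFn
    exact h (k + 1) k.succ_pos a f (fun j => (ha j).1) (fun j => (ha j).2)
      fun j hj => hf ⟨j, by omega⟩
  · intro h k hk a f ha hφ hf
    obtain ⟨k, rfl⟩ : ∃ k', k = k' + 1 := ⟨k - 1, by omega⟩
    exact h _ _ (altProd_ofFn a f (fun j => ⟨ha j, hφ j⟩) fun j => hf j (by omega))

section Freeness

/-- The algebra generated by `D` and the variables. -/
abbrev varAlg (X : Fin n → M) (D : Subalgebra ℂ M) : Subalgebra ℂ M :=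
  D ⊔ Algebra.adjoin ℂ (Set.range X)

theorem IsTower.map_eq_zero_of_altProd (T : IsTower B D E F)
    (hF : ∀ b₁ ∈ B, (∀ b₂ ∈ B, F (b₁ * b₂) = 0) → b₁ = 0)
    (hfree : IsFreeWithAmalgamation (F ∘ₗ E) (varAlg X D : Set M) (B : Set M)) {m : M}
    (hm : AltProd (centered (F ∘ₗ E) (varAlg X D : Set M) (B : Set M)) true m) : E m = 0 := by
  rw [isFreeWithAmalgamation_iff] at hfree
  refine hF _ (T.condExp.2.1 m) fun b hb => ?_
  have hFb := T.map_mem b hb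
  have h1 : F (E (m * (b - F b))) = 0 := by
    refine hfree _ _ (hm.snoc ⟨B.sub_mem hb (T.le hFb), ?_⟩)
    rw [LinearMap.comp_apply, T.condExp.map_of_mem (B.sub_mem hb (T.le hFb)), map_sub,
      T.map_of_mem hFb, sub_self]
  have h2 : F (E m) = 0 := hfree _ _ hm
  rw [mul_sub, map_sub, map_sub, T.condExp.map_right_mul hb,
    T.condExp.map_right_mul (T.le hFb), T.map_right_mul hFb (T.condExp.2.1 m), h2, zero_mul,
    sub_zero] at h1
  exact h1

theorem IsTower.map_mem_of_free (T : IsTower B D E F)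
    (hF : ∀ b₁ ∈ B, (∀ b₂ ∈ B, F (b₁ * b₂) = 0) → b₁ = 0)
    (hfree : IsFreeWithAmalgamation (F ∘ₗ E) (varAlg X D : Set M) (B : Set M))
    {w : BlockOp F n} (hw : w ∈ opAlg E F X D) : E w.1 ∈ D := by
  have hd : F (E w.1) ∈ D := T.map_mem _ (T.condExp.2.1 _)
  have h := T.map_eq_zero_of_altProd hF hfree (m := w.1 - F (E w.1)) (.single ⟨?_, ?_⟩)
  · rw [map_sub, sub_eq_zero, T.condExp.map_of_mem (T.le hd)] at h
    rwa [h]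
  · exact Subalgebra.sub_mem _ (exists_mem_opAlg_iff.2 ⟨w, hw, rfl⟩) (SetLike.le_def.1 le_sup_left hd)
  · simp [T.condExp.map_of_mem (T.le hd), T.map_of_mem hd]

theorem altProd_mul {S : Bool → Set M} (hQ : ∀ q ∈ centeredBase F n B, q.1 ∈ S false)
    (hP : ∀ q ∈ centeredOps E F X D, q.1 ∈ S true) {u : M} (hu : AltProd S true u) {k : ℕ}
    {v : BlockOp F n} (hv : AltOp B D E F X k v) : AltProd S false (u * v.1) := by
  induction hv with
  | single hb => exact hu.snoc (hQ _ hb)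
  | step _ hq hb ih =>
    rw [Prod.fst_mul, Prod.fst_mul, ← mul_assoc, ← mul_assoc]
    exact (ih.snoc (hP _ hq)).snoc (hQ _ hb)

theorem Alternating.altProd {S : Bool → Set M} (hQ : ∀ q ∈ centeredBase F n B, q.1 ∈ S false)
    (hP : ∀ q ∈ centeredOps E F X D, q.1 ∈ S true) {k : ℕ}
    {v : BlockOp F n} (hv : AltOp B D E F X k v) : AltProd S false v.1 := by
  induction hv with
  | single hb => exact .single (hQ _ hb)
  | step _ hq hb ih => exact (ih.snoc (hP _ hq)).snoc (hQ _ hb)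

theorem IsTower.fst_mem_centered_false (T : IsTower B D E F) {S₁ : Set M} {q : BlockOp F n}
    (hq : q ∈ centeredBase F n B) : q.1 ∈ centered (F ∘ₗ E) S₁ (B : Set M) false := by
  obtain ⟨b, hb, rfl⟩ := hq
  exact ⟨hb.1, by simp [T.condExp.map_of_mem hb.1, hb.2]⟩

theorem fst_mem_centered_true {S₂ : Set M} {q : BlockOp F n} (hq : q ∈ centeredOps E F X D) :
    q.1 ∈ centered (F ∘ₗ E) (varAlg X D : Set M) S₂ true :=
  ⟨exists_mem_opAlg_iff.2 ⟨q, hq.1, rfl⟩, by simp [hq.2]⟩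

theorem IsTower.annihilates_of_free (T : IsTower B D E F)
    (hF : ∀ b₁ ∈ B, (∀ b₂ ∈ B, F (b₁ * b₂) = 0) → b₁ = 0)
    (hfree : IsFreeWithAmalgamation (F ∘ₗ E) (varAlg X D : Set M) (B : Set M))
    {w : BlockOp F n} (hw : w ∈ opAlg E F X D) (k : ℕ) : Annihilates B D E F X w.1 k := by
  intro k' _ v hv q hq
  have hQ := fun q hq => T.fst_mem_centered_false (n := n) (S₁ := (varAlg X D : Set M)) (q := q) hq
  have hP := fun q hq => fst_mem_centered_true (E := E) (F := F) (X := X) (D := D)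
    (S₂ := (B : Set M)) (q := q) hq
  obtain ⟨r, hr, d, hd, rfl⟩ := T.exists_eq_add_baseOp
    (fun w hw => T.map_mem_of_free hF hfree hw) hw
  rw [Prod.fst_add, fst_baseOp, add_mul, add_mul, map_add,
    T.map_eq_zero_of_altProd hF hfree ((altProd_mul hQ hP (.single (hP r hr)) hv).snoc (hP q hq)),
    zero_add, mul_assoc, T.condExp.map_left_mul (T.le hd),
    T.map_eq_zero_of_altProd hF hfree ((hv.altProd hQ hP).snoc (hP q hq)), mul_zero]

theorem IsTower.free_of_annihilates (T : IsTower B D E F)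
    (hD : ∀ w ∈ opAlg E F X D, E w.1 ∈ D)
    (hA : ∀ w ∈ opAlg E F X D, ∀ k, Annihilates B D E F X w.1 k) :
    IsFreeWithAmalgamation (F ∘ₗ E) (varAlg X D : Set M) (B : Set M) := by
  rw [isFreeWithAmalgamation_iff]
  have hP : ∀ m ∈ centered (F ∘ₗ E) (varAlg X D : Set M) (B : Set M) true,
      ∃ q ∈ centeredOps E F X D, q.1 = m := by
    rintro m ⟨hm, h0⟩
    obtain ⟨q, hq, rfl⟩ :=
      (exists_mem_opAlg_iff (E := E) (F := F) (X := X) (D := D)).1 (by simpa using hm)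
    exact ⟨q, ⟨hq, by rw [← T.map_of_mem (hD q hq)]; exact h0⟩, rfl⟩
  have hQ : ∀ m ∈ centered (F ∘ₗ E) (varAlg X D : Set M) (B : Set M) false,
      ∃ q ∈ centeredBase F n B, q.1 = m := by
    rintro m ⟨hm, h0⟩
    exact ⟨baseOp F n m, ⟨m, ⟨hm, by
      rwa [LinearMap.comp_apply, T.condExp.map_of_mem hm] at h0⟩, rfl⟩, rfl⟩
  have key : ∀ e m, AltProd (centered (F ∘ₗ E) (varAlg X D : Set M) (B : Set M)) e m →
      cond e ((∃ q ∈ centeredOps E F X D, q.1 = m) ∨ ∃ w ∈ opAlg E F X D, ∃ k v,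
          AltOp B D E F X k v ∧ ∃ q ∈ centeredOps E F X D, w.1 * v.1 * q.1 = m)
        (∃ w ∈ opAlg E F X D, ∃ k v, AltOp B D E F X k v ∧ w.1 * v.1 = m) := by
    intro e m h
    induction h with
    | @single e m hm =>
      cases e with
      | false =>
        obtain ⟨q, hq, rfl⟩ := hQ m hm
        exact ⟨1, one_mem _, 0, q, .single hq, by simp⟩
      | true => exact Or.inl (hP m hm)
    | @snoc e u m _ hm ih =>
      cases e with
      | false =>
        obtain ⟨q, hq, rfl⟩ := hP m hm
        obtain ⟨w, hw, k, v, hv, rfl⟩ := ih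
        exact Or.inr ⟨w, hw, k, v, hv, q, hq, rfl⟩
      | true =>
        obtain ⟨b, hb, rfl⟩ := hQ m hm
        obtain ⟨q, hq, rfl⟩ | ⟨w, hw, k, v, hv, q, hq, rfl⟩ := ih
        · exact ⟨q, hq.1, 0, b, .single hb, rfl⟩
        · exact ⟨w, hw, k + 1, _, hv.step hq hb, by simp [mul_assoc]⟩
  intro e m hm
  have h := key e m hm
  cases e with
  | false =>
    obtain ⟨w, hw, k, v, hv, rfl⟩ := h
    simpa using (hA w hw k).map_eq_zero T hD (hD w hw) le_rfl hv (one_mem _)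
  | true =>
    obtain ⟨q, hq, rfl⟩ | ⟨w, hw, k, v, hv, q, hq, rfl⟩ := h
    · simp [hq.2]
    · rw [LinearMap.comp_apply, hA w hw k k le_rfl v hv q hq, map_zero]

end Freeness

section Series

variable (κ : ∀ n : ℕ, MultilinearMap ℂ (fun _ : Fin n => M) M)

/-- The cumulant of a block after applying `F` to the gaps. -/
def factorKernel (F : M →ₗ[ℂ] M) (X : Fin n → M) (p : List (Fin n × M)) (i : Fin n) : M :=
  cumList κ (letters X (p.map (Prod.map id F)) ++ [X i])

theorem factorKernel_of_forall {p : List (Fin n × M)} (hp : ∀ y ∈ p, F y.2 = y.2) (i : Fin n) :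
    factorKernel κ F X p i = cumList κ (letters X p ++ [X i]) := by
  have h : ∀ y ∈ p, Prod.map id F y = id y := fun y hy => Prod.ext rfl (hp y hy)
  rw [factorKernel, List.map_congr_left h, List.map_id]

theorem isBlockKernel_factorKernel (F : M →ₗ[ℂ] M) (X : Fin n → M) :
    IsBlockKernel F (factorKernel κ F X) := by
  have h : ∀ p j q i β, factorKernel κ F X (p ++ (j, β) :: q) i =
      cumList κ (letters X (p.map (Prod.map id F)) ++
        (X j * F β) :: (letters X (q.map (Prod.map id F)) ++ [X i])) := by
    intro p j q i β
    simp [factorKernel, letters]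
  have hlin := fun (p q : List (Fin n × M)) (i : Fin n) => isLinearMap_cumList κ (letters X (p.map (Prod.map id F)))
    (letters X (q.map (Prod.map id F)) ++ [X i])
  refine ⟨fun p j q i => ⟨fun β γ => ?_, fun c β => ?_⟩, fun p j q i β hβ => ?_⟩
  · simp only [h, map_add, mul_add, (hlin p q i).map_add]
  · simp only [h, map_smul, mul_smul_comm, (hlin p q i).map_smul]
  · rw [h, hβ, mul_zero, (hlin p q i).map_zero]

theorem IsBlockKernel.map {K : List (Fin n × M) → Fin n → M} (hK : IsBlockKernel F K)
    (φ : M →ₗ[ℂ] M) : IsBlockKernel F fun p i => φ (K p i) :=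
  ⟨fun p j q i => ⟨fun β γ => by simp only [(hK.linear p j q i).map_add, map_add],
    fun c β => by simp only [(hK.linear p j q i).map_smul, map_smul]⟩,
    fun p j q i β h => by rw [hK.null p j q i β h, map_zero]⟩

theorem cumulantSeries_eq {k : ℕ} (i : Fin (k + 1) → Fin n) (b : Fin k → M) :
    cumulantSeries κ X i b =
      cumList κ (letters X (List.ofFn fun j => (i j.castSucc, b j)) ++ [X (i (Fin.last k))]) := by
  rw [cumulantSeries, ← cumList_ofFn, List.ofFn_succ', List.concat_eq_append]
  congr 2
  · simp [letters, List.map_ofFn, Function.comp_def]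
  · simp

theorem cumulantSeries_map {k : ℕ} (i : Fin (k + 1) → Fin n) (b : Fin k → M) :
    (cumulantSeries κ X i fun j => F (b j)) =
      factorKernel κ F X (List.ofFn fun j => (i j.castSucc, b j)) (i (Fin.last k)) := by
  rw [cumulantSeries_eq, factorKernel, List.map_ofFn]
  rfl

theorem exists_eq_ofFn {α β : Type*} (p : List (α × β)) (i : α) :
    ∃ (i' : Fin (p.length + 1) → α) (b : Fin p.length → β),
      (∀ j, ∃ y ∈ p, y.2 = b j) ∧ (List.ofFn fun j => (i' j.castSucc, b j)) = p ∧
        i' (Fin.last _) = i := by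
  refine ⟨Fin.snoc (fun j => p[j].1) i, fun j => p[j].2,
    fun j => ⟨p[j], List.getElem_mem _, rfl⟩, ?_, by simp⟩
  refine List.ext_getElem (by simp) fun j _ _ => ?_
  simp [Fin.snoc]

end Series

end Operators

theorem freeness_iff_cumulant_factorization
    (B D : Subalgebra ℂ M) (hDB : D ≤ B)
    (E F : M →ₗ[ℂ] M) (hE : IsCondExp B E)
    (hF1 : F 1 = 1) (hFD : ∀ b ∈ B, F b ∈ D)
    (hFbimod : ∀ d ∈ D, ∀ d' ∈ D, ∀ b ∈ B, F (d * b * d') = d * F b * d')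
    (hFfaithful : ∀ b₁ ∈ B, (∀ b₂ ∈ B, F (b₁ * b₂) = 0) → b₁ = 0)
    (κB κD : ∀ n : ℕ, MultilinearMap ℂ (fun _ : Fin n => M) M)
    (hκB : IsCumulantFamily B E κB) (hκD : IsCumulantFamily D (F ∘ₗ E) κD)
    {n : ℕ} (X : Fin n → M) :
    (IsFreeWithAmalgamation (F ∘ₗ E)
        ((D ⊔ Algebra.adjoin ℂ (Set.range X) : Subalgebra ℂ M) : Set M)
        (B : Set M) ↔
      ∀ (k : ℕ) (i : Fin (k + 1) → Fin n) (b : Fin k → M), (∀ j, b j ∈ B) →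
        cumulantSeries κB X i b = F (cumulantSeries κB X i fun j => F (b j))) ∧
    (IsFreeWithAmalgamation (F ∘ₗ E)
        ((D ⊔ Algebra.adjoin ℂ (Set.range X) : Subalgebra ℂ M) : Set M)
        (B : Set M) ↔
      ∀ (k : ℕ) (i : Fin (k + 1) → Fin n) (b : Fin k → M), (∀ j, b j ∈ B) →
        cumulantSeries κB X i b = cumulantSeries κD X i fun j => F (b j)) := by
  have T : IsTower B D E F := ⟨hDB, hE, hF1, hFD, hFbimod⟩
  have hFF : ∀ b ∈ B, F (F b) = F b := fun b hb => T.map_of_mem (hFD b hb)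
  have hentries : ∀ {k : ℕ} (i : Fin (k + 1) → Fin n) (b : Fin k → M), (∀ j, b j ∈ B) →
      ∀ y ∈ List.ofFn fun j => (i j.castSucc, b j), y.2 ∈ B := by
    intro k i b hb y hy
    obtain ⟨j, rfl⟩ := List.mem_ofFn.1 hy
    exact hb j
  have free_factor (hfree : IsFreeWithAmalgamation (F ∘ₗ E) (varAlg X D : Set M) (B : Set M))
      (k : ℕ) (i : Fin (k + 1) → Fin n) (b : Fin k → M) (hb : ∀ j, b j ∈ B) :
      cumulantSeries κB X i b = cumulantSeries κD X i fun j => F (b j) := by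
    rw [cumulantSeries_eq, cumulantSeries_map]
    exact (T.kernel_eq_of_annihilates (fun w hw => T.map_mem_of_free hFfaithful hfree hw)
      (fun w hw => T.annihilates_of_free hFfaithful hfree hw) hκB hκD
      (isBlockKernel_factorKernel κD F X)
      (fun p i hp => factorKernel_of_forall κD (fun y hy => T.map_of_mem (hp y hy)) i)
      _ _ (hentries i b hb)).symm
  have factor_map (h : ∀ (k : ℕ) (i : Fin (k + 1) → Fin n) (b : Fin k → M), (∀ j, b j ∈ B) →
        cumulantSeries κB X i b = cumulantSeries κD X i fun j => F (b j))
      (k : ℕ) (i : Fin (k + 1) → Fin n) (b : Fin k → M) (hb : ∀ j, b j ∈ B) :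
      cumulantSeries κB X i b = F (cumulantSeries κB X i fun j => F (b j)) := by
    rw [h k i b hb, h k i _ fun j => hDB (hFD _ (hb j))]
    simp only [fun j => hFF _ (hb j)]
    exact (T.map_of_mem (hκD.mem _ _)).symm
  have map_free (h : ∀ (k : ℕ) (i : Fin (k + 1) → Fin n) (b : Fin k → M), (∀ j, b j ∈ B) →
        cumulantSeries κB X i b = F (cumulantSeries κB X i fun j => F (b j))) :
      IsFreeWithAmalgamation (F ∘ₗ E) (varAlg X D : Set M) (B : Set M) := by
    have hK := (isBlockKernel_factorKernel κB F X).map F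
    have hKD : ∀ p i, F (factorKernel κB F X p i) ∈ D := fun p i => hFD _ (hκB.mem _ _)
    have hKκ : ∀ p i, (∀ y ∈ p, y.2 ∈ B) →
        F (factorKernel κB F X p i) = cumList κB (letters X p ++ [X i]) := by
      intro p i hp
      obtain ⟨i', b, hb, h1, h2⟩ := exists_eq_ofFn p i
      have h3 := h _ i' b fun j => by
        obtain ⟨y, hy, hyb⟩ := hb j
        exact hyb ▸ hp y hy
      rw [cumulantSeries_eq, cumulantSeries_map, h1, h2] at h3
      exact h3.symm
    exact T.free_of_annihilates (fun w hw => T.map_mem_of_kernel hκB hK hKκ hKD hw)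
      (fun w hw => T.annihilates_of_kernel hκB hK hKκ hKD hw)
  exact ⟨⟨fun h => factor_map (free_factor h), map_free⟩,
    ⟨free_factor, fun h => map_free (factor_map h)⟩⟩

end OVD
end
end
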